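/- Convergence of the scaled Gaussian input (Lemma 1, light traffic). Assume that r_i(u) → ∞ as u → ∞ for every i ∈ {1,…,n} and that the model satisfies L1, L2, N1, N2 and N3. Then, for every T > 0, the n-dimensional process Jᵟ_u(·) = (J(δ(r_1(u))·)/σ(δ(r_1(u))), …, J(δ(r_n(u))·)/σ(δ(r_n(u))))ᵀ converges in distribution in C([−T,T] → ℝⁿ), as u → ∞, to B_λ(·). -/

import Mathlib

open MeasureTheory ProbabilityTheory Filter Topology

noncomputable section

/-- Covariance function of a centered Gaussian process with stationary increments
and standard deviation function `σ`:
`Cov(J(t), J(s)) = (σ²(|t|) + σ²(|s|) − σ²(|t−s|))/2`. -/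
def covFromStd (σ : ℝ → ℝ) : ℝ → ℝ → ℝ := fun t s =>
  (σ |t| ^ 2 + σ |s| ^ 2 - σ |t - s| ^ 2) / 2

/-- `X` is a real-valued centered Gaussian process (indexed by `ℝ`) with covariance
function `K`, under the measure `P`: every finite linear combination of its values is a
centered Gaussian real random variable with the variance prescribed by `K`. -/
def IsCenteredGaussian1 {Ω : Type*} [MeasurableSpace Ω] (P : Measure Ω)
    (X : ℝ → Ω → ℝ) (K : ℝ → ℝ → ℝ) : Prop :=
  (∀ t, Measurable (X t)) ∧
  ∀ (k : ℕ) (t : Fin k → ℝ) (c : Fin k → ℝ),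
    P.map (fun ω => ∑ a, c a * X (t a) ω)
      = gaussianReal 0 (∑ a, ∑ b, c a * c b * K (t a) (t b)).toNNReal

/-- `X` is an `n`-dimensional centered Gaussian process with matrix covariance function
`K` (`K i j t s = Cov(Xᵢ(t), Xⱼ(s))`) under the measure `P`. -/
def IsCenteredGaussianVec {Ω : Type*} [MeasurableSpace Ω] {n : ℕ} (P : Measure Ω)
    (X : ℝ → Ω → Fin n → ℝ) (K : Fin n → Fin n → ℝ → ℝ → ℝ) : Prop :=
  (∀ t i, Measurable fun ω => X t ω i) ∧
  ∀ (k : ℕ) (t : Fin k → ℝ) (c : Fin k → Fin n → ℝ),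
    P.map (fun ω => ∑ a, ∑ i, c a i * X (t a) ω i)
      = gaussianReal 0
          (∑ a, ∑ b, ∑ i, ∑ j, c a i * c b j * K i j (t a) (t b)).toNNReal

/-- Covariance of the limiting fractional-Brownian-type process with Hurst-type
parameter `h` and rate ratio `ρv`; the exponent `1/(h−1)` equals `−κ` in the
light-traffic case (`h = λ`, `κ = (1−λ)⁻¹`) and `ξ` in the heavy-traffic case (`h = α`). -/
def limCov (h ρv t s : ℝ) : ℝ :=
  if 0 < ρv then
    (|t| ^ (2 * h) + |ρv ^ (1 / (h - 1)) * s| ^ (2 * h)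
        - |t - ρv ^ (1 / (h - 1)) * s| ^ (2 * h)) / (2 * ρv ^ (1 / (h - 1) * h))
  else 0

/-- Matrix covariance function of the limiting `n`-dimensional Gaussian process `B`. -/
def limCovMat {n : ℕ} (h : ℝ) (ρ : Fin n → Fin n → ℝ) (i j : Fin n) (t s : ℝ) : ℝ :=
  if i ≤ j then limCov h (ρ i j) t s else limCov h (ρ j i) s t

/-- The stationary reflected (workload) map:
`X̄(t) = sup_{−∞ < s < t} (c (J(t) − J(s)) − rate (t − s))`. -/
def XbarProc {Ω : Type*} (J : ℝ → Ω → ℝ) (c rate t : ℝ) (ω : Ω) : ℝ :=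
  ⨆ s : Set.Iio t, (c * (J t ω - J (↑s) ω) - rate * (t - ↑s))

/-- Convergence in distribution, as `u → ∞`, of the processes `X u` (on `(Ω, P)`) to `Y`
(on `(Ω', P')`), viewed as random elements of the space of functions on `I` carrying the
topology of uniform convergence on compact subsets of `I`: the expectations of every
bounded continuous functional converge. -/
def TendstoInDistOnCompacts {Ω Ω' : Type*} [MeasurableSpace Ω] [MeasurableSpace Ω']
    (P : Measure Ω) (P' : Measure Ω') (I : Set ℝ) (n : ℕ)
    (X : ℝ → Ω → ℝ → Fin n → ℝ) (Y : Ω' → ℝ → Fin n → ℝ) : Prop :=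
  ∀ F : BoundedContinuousFunction
      (UniformOnFun ↥I (Fin n → ℝ) {K : Set ↥I | IsCompact K}) ℝ,
    Tendsto
      (fun u => ∫ ω, F (UniformOnFun.ofFun {K : Set ↥I | IsCompact K}
          (fun t : ↥I => X u ω ↑t)) ∂P)
      atTop
      (𝓝 (∫ ω, F (UniformOnFun.ofFun {K : Set ↥I | IsCompact K}
          (fun t : ↥I => Y ω ↑t)) ∂P'))



lemma gcl_half {σ : ℝ → ℝ} (hσpos : ∀ t > (0:ℝ), 0 < σ t) {lam : ℝ} 
    (hL1 : ∀ t > (0:ℝ), Tendsto (fun x => σ (t * x) / σ x) (𝓝[>] 0) (𝓝 (t ^ lam)))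
    (t : ℝ) (ht : 0 < t) (m : ℝ) (hm : t ^ lam < m) :
    ∃ d0 > (0:ℝ), ∀ d, 0 < d → d ≤ d0 → σ (t * d) ≤ m * σ d := by
  have h := (hL1 t ht).eventually_le_const hm
  rw [eventually_nhdsWithin_iff, Metric.eventually_nhds_iff] at h
  obtain ⟨e, he, h⟩ := h
  refine ⟨e / 2, by positivity, fun d hd hde => ?_⟩
  have := h (y := d) (by rw [Real.dist_eq, sub_zero, abs_of_pos hd]; linarith) hd
  rwa [div_le_iff₀ (hσpos d hd)] at this

lemma gcl_mono {σ : ℝ → ℝ} (hσcont : ContinuousOn σ (Set.Ici 0)) (hσ0 : σ 0 = 0)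
    (tri : ∀ a b : ℝ, σ |a + b| ≤ σ |a| + σ |b|)
    (hσpos : ∀ t > (0:ℝ), 0 < σ t) {θ d0 : ℝ} (hθ0 : 0 < θ) (hθ : θ < 1)
    (hhalf : ∀ d, 0 < d → d ≤ d0 → σ (2⁻¹ * d) ≤ θ * σ d) :
    ∀ d y, 0 < d → d ≤ d0 → 0 ≤ y → y ≤ d → σ y ≤ θ / (1 - θ) * σ d + σ d := by
  intro d y hd hd0 hy hyd
  have h1 : 0 < 1 - θ := by linarith
  set c := θ / (1 - θ) + 1 with hc
  have hc' : (1 + c) * θ ≤ c := by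
    rw [hc]; field_simp; nlinarith
  have hcpos : 0 < c := by positivity
  suffices h : σ y ≤ c * σ d by rw [hc] at h; linarith
  refine le_of_forall_pos_le_add fun ε hε => ?_
  have hc0 := hσcont 0 (by simp)
  rw [Metric.continuousWithinAt_iff] at hc0
  obtain ⟨η, hη, hc0⟩ := hc0 ε hε
  have key : ∀ N : ℕ, ∀ d y, 0 < d → d ≤ d0 → d < 2 ^ N * η → 0 ≤ y → y ≤ d → 
      σ y ≤ c * σ d + ε := by
    intro N
    induction N with
    | zero => 
      intro d y hd hd0 hdη hy hyd
      have := hc0 (x := y) hy (by rw [Real.dist_eq, sub_zero, abs_of_nonneg hy]; simp at hdη; linarith)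
      rw [Real.dist_eq, hσ0, sub_zero] at this
      have h2 := (abs_lt.1 this).2
      have := hσpos d hd
      nlinarith [mul_pos hcpos this]
    | succ N ih =>
      intro d y hd hd0 hdη hy hyd
      have hh := hhalf d hd hd0
      have hdN : 2⁻¹ * d < 2 ^ N * η := by rw [pow_succ] at hdη; linarith
      have hp := hσpos d hd
      rcases le_total y (2⁻¹ * d) with h | h
      · have := ih (2⁻¹ * d) y (by linarith) (by linarith) hdN hy h
        have h3 : c * σ (2⁻¹ * d) ≤ c * (θ * σ d) := by gcongr
        have h4 : c * (θ * σ d) ≤ c * σ d := by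
          gcongr; nlinarith
        linarith
      · have := ih (2⁻¹ * d) (y - 2⁻¹ * d) (by linarith) (by linarith) hdN (by linarith) (by linarith)
        have ht := tri (2⁻¹ * d) (y - 2⁻¹ * d)
        rw [abs_of_nonneg (by linarith), abs_of_nonneg (by linarith), abs_of_nonneg (by linarith)] at ht
        rw [show 2⁻¹ * d + (y - 2⁻¹ * d) = y by ring] at ht
        have h3 : (1 + c) * σ (2⁻¹ * d) ≤ (1 + c) * (θ * σ d) := by gcongr
        have h4 : (1 + c) * (θ * σ d) ≤ c * σ d := by nlinarith
        linarith
  obtain ⟨N, hN⟩ := pow_unbounded_of_one_lt (d / η) (one_lt_two)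
  exact key N d y hd hd0 (by rwa [div_lt_iff₀ hη] at hN) hy hyd

lemma gcl_half_pow {σ : ℝ → ℝ} {θ d0 : ℝ} (hθ0 : 0 < θ)
    (hhalf : ∀ d, 0 < d → d ≤ d0 → σ (2⁻¹ * d) ≤ θ * σ d) (k : ℕ) :
    ∀ d, 0 < d → d ≤ d0 → σ (2⁻¹ ^ k * d) ≤ θ ^ k * σ d := by
  induction k with
  | zero => intro d _ _; simp
  | succ k ih =>
    intro d hd hd0
    have h1 : (2⁻¹:ℝ) ^ k * d ≤ d := mul_le_of_le_one_left hd.le (pow_le_one₀ (by norm_num) (by norm_num))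
    have := hhalf (2⁻¹ ^ k * d) (by positivity) (by linarith)
    calc σ (2⁻¹ ^ (k+1) * d) = σ (2⁻¹ * (2⁻¹ ^ k * d)) := by ring_nf
      _ ≤ θ * σ (2⁻¹ ^ k * d) := this
      _ ≤ θ * (θ ^ k * σ d) := by gcongr; exact ih d hd hd0
      _ = _ := by ring

lemma gcl_double_pow {σ : ℝ → ℝ} {θ d0 : ℝ} (hθ0 : 0 < θ)
    (hdbl : ∀ d, 0 < d → d ≤ d0 → σ (2 * d) ≤ θ * σ d) (k : ℕ) :
    ∀ d, 0 < d → 2 ^ k * d ≤ d0 → σ (2 ^ k * d) ≤ θ ^ k * σ d := by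
  induction k with
  | zero => intro d _ _; simp
  | succ k ih =>
    intro d hd hd0
    have h0 : (0:ℝ) < 2 ^ k * d := by positivity
    have h1 : (2:ℝ) ^ k * d ≤ d0 := by rw [pow_succ] at hd0; linarith
    have := hdbl (2 ^ k * d) (by positivity) (by linarith)
    calc σ (2 ^ (k+1) * d) = σ (2 * (2 ^ k * d)) := by ring_nf
      _ ≤ θ * σ (2 ^ k * d) := this
      _ ≤ θ * (θ ^ k * σ d) := by gcongr; exact ih d hd h1
      _ = _ := by ring

lemma gcl_potter {σ : ℝ → ℝ} (hσcont : ContinuousOn σ (Set.Ici 0)) (hσ0 : σ 0 = 0)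
    (tri : ∀ a b : ℝ, σ |a + b| ≤ σ |a| + σ |b|)
    (hσpos : ∀ t > (0:ℝ), 0 < σ t)  {lam : ℝ} (hlam : lam ∈ Set.Ioo (0:ℝ) 1)
    (hL1 : ∀ t > (0:ℝ), Tendsto (fun x => σ (t * x) / σ x) (𝓝[>] 0) (𝓝 (t ^ lam))) :
    ∃ d0 > (0:ℝ), ∃ C > (0:ℝ), ∃ γ > (0:ℝ), ∃ γ' ∈ Set.Ioo (0:ℝ) 1,
      (∀ d x, 0 < d → d ≤ d0 → 0 ≤ x → x ≤ 1 → σ (d * x) ≤ C * x ^ γ * σ d) ∧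
      (∀ d x, 0 < d → 1 ≤ x → d * x ≤ d0 → σ (d * x) ≤ C * x ^ γ' * σ d) := by
  obtain ⟨hl0, hl1⟩ := hlam
  set γ := lam / 2 with hγ
  set γ' := (1 + lam) / 2 with hγ'
  obtain ⟨a, ha, hhalf⟩ := gcl_half hσpos hL1 2⁻¹ (by norm_num) ((2⁻¹:ℝ) ^ γ)
    (Real.rpow_lt_rpow_of_exponent_gt (by norm_num) (by norm_num) (by linarith))
  obtain ⟨b, hb, hdbl⟩ := gcl_half hσpos hL1 2 (by norm_num) ((2:ℝ) ^ γ')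
    (Real.rpow_lt_rpow_of_exponent_lt (by norm_num) (by linarith))
  have hθ0 : 0 < (2⁻¹:ℝ) ^ γ := by positivity
  have hθ1 : (2⁻¹:ℝ) ^ γ < 1 := Real.rpow_lt_one (by norm_num) (by norm_num) (by linarith)
  have hmono := gcl_mono hσcont hσ0 tri hσpos hθ0 hθ1 hhalf
  set c := (2⁻¹:ℝ) ^ γ / (1 - (2⁻¹:ℝ) ^ γ) + 1 with hc
  have hcpos : 0 < c := by
    have : 0 < 1 - (2⁻¹:ℝ) ^ γ := by linarith
    positivity
  replace hmono : ∀ d y, 0 < d → d ≤ a → 0 ≤ y → y ≤ d → σ y ≤ c * σ d := by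
    intro d y h1 h2 h3 h4
    rw [hc, add_mul, one_mul]; exact hmono d y h1 h2 h3 h4
  refine ⟨min a b / 2, by positivity, c * 2, by positivity, γ, by positivity, γ', ⟨by positivity, by linarith⟩, ?_, ?_⟩
  · intro d x hd hd0 hx hx1
    have hda : d ≤ a := by have := min_le_left a b; linarith
    rcases hx.eq_or_lt with rfl | hx
    · simp [hσ0, Real.zero_rpow (show γ ≠ 0 by positivity)]
    obtain ⟨k, hk1, hk2⟩ := exists_nat_pow_near_of_lt_one hx hx1 (show (0:ℝ) < 2⁻¹ by norm_num) (by norm_num)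
    have hp := hσpos d hd
    have h1 := gcl_half_pow hθ0 hhalf k d hd hda
    have hkd : (2⁻¹:ℝ) ^ k * d ≤ d := mul_le_of_le_one_left hd.le (pow_le_one₀ (by norm_num) (by norm_num))
    have h2 := hmono (2⁻¹ ^ k * d) (d * x) (by positivity) (by linarith) (by positivity)
      (by rw [mul_comm d x]; gcongr)
    have h3 : ((2⁻¹:ℝ) ^ γ) ^ k ≤ 2 * x ^ γ := by
      calc ((2⁻¹:ℝ) ^ γ) ^ k = ((2⁻¹:ℝ) ^ k) ^ γ := by
            rw [← Real.rpow_natCast, ← Real.rpow_natCast, ← Real.rpow_mul (by norm_num), ← Real.rpow_mul (by norm_num), mul_comm]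
        _ ≤ (2 * x) ^ γ := by
            gcongr
            rw [pow_succ] at hk1; linarith
        _ = 2 ^ γ * x ^ γ := Real.mul_rpow (by norm_num) hx.le
        _ ≤ 2 * x ^ γ := by
            gcongr
            calc (2:ℝ) ^ γ ≤ 2 ^ (1:ℝ) := Real.rpow_le_rpow_of_exponent_le (by norm_num) (by linarith)
              _ = 2 := by simp
    calc σ (d * x) ≤ c * σ (2⁻¹ ^ k * d) := h2
      _ ≤ c * (2 * x ^ γ * σ d) := by
          gcongr; exact h1.trans (by gcongr)
      _ = _ := by ring
  · intro d x hd hx hdx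
    have hdx' : 2 * (d * x) ≤ min a b := by linarith
    have hxpos : 0 < x := by linarith
    have hp := hσpos d hd
    obtain ⟨k, hk1, hk2⟩ := exists_nat_pow_near hx (one_lt_two (α := ℝ))
    have hle : (2:ℝ) ^ (k+1) * d ≤ min a b := by
      refine le_trans ?_ hdx'
      rw [pow_succ]; nlinarith
    have h1 := gcl_double_pow (θ := (2:ℝ) ^ γ') (by positivity) hdbl (k+1) d hd (hle.trans (min_le_right _ _))
    have h2 := hmono (2 ^ (k+1) * d) (d * x) (by positivity) (hle.trans (min_le_left _ _)) (by positivity)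
      (by rw [mul_comm d x]; gcongr)
    have h3 : ((2:ℝ) ^ γ') ^ (k+1) ≤ 2 * x ^ γ' := by
      calc ((2:ℝ) ^ γ') ^ (k+1) = ((2:ℝ) ^ (k+1)) ^ γ' := by
            rw [← Real.rpow_natCast, ← Real.rpow_natCast, ← Real.rpow_mul (by norm_num), ← Real.rpow_mul (by norm_num), mul_comm]
        _ ≤ (2 * x) ^ γ' := by
            have : 0 ≤ γ' := by linarith
            gcongr
            rw [pow_succ]; linarith
        _ = 2 ^ γ' * x ^ γ' := Real.mul_rpow (by norm_num) hxpos.le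
        _ ≤ 2 * x ^ γ' := by
            gcongr
            calc (2:ℝ) ^ γ' ≤ 2 ^ (1:ℝ) := Real.rpow_le_rpow_of_exponent_le (by norm_num) (by linarith)
              _ = 2 := by simp
    calc σ (d * x) ≤ c * σ (2 ^ (k+1) * d) := h2
      _ ≤ c * (2 * x ^ γ' * σ d) := by
          gcongr; exact h1.trans (by gcongr)
      _ = _ := by ring

/-- uniform-type convergence -/
lemma gcl_conv {σ : ℝ → ℝ} (hσ0 : σ 0 = 0)
    (tri : ∀ a b : ℝ, σ |a + b| ≤ σ |a| + σ |b|)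
    (hσpos : ∀ t > (0:ℝ), 0 < σ t)  {lam : ℝ} (hlam : lam ∈ Set.Ioo (0:ℝ) 1)
    (hL1 : ∀ t > (0:ℝ), Tendsto (fun x => σ (t * x) / σ x) (𝓝[>] 0) (𝓝 (t ^ lam)))
    {d0 C γ : ℝ} (hd0 : 0 < d0) (hγ : 0 < γ)
    (hpot : ∀ d x, 0 < d → d ≤ d0 → 0 ≤ x → x ≤ 1 → σ (d * x) ≤ C * x ^ γ * σ d)
    {ι : Type*} {l : Filter ι} {d x : ι → ℝ} {y : ℝ} (hd : Tendsto d l (𝓝[>] 0))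
    (hx : Tendsto x l (𝓝 y)) :
    Tendsto (fun u => σ |d u * x u| / σ (d u)) l (𝓝 (|y| ^ lam)) := by
  have hdpos : ∀ᶠ u in l, 0 < d u := hd self_mem_nhdsWithin
  have hd0' : ∀ᶠ u in l, d u ≤ d0 := 
    (hd.mono_right nhdsWithin_le_nhds).eventually_le_const hd0
  have h1 : Tendsto (fun u => σ |d u * y| / σ (d u)) l (𝓝 (|y| ^ lam)) := by
    rcases eq_or_ne y 0 with rfl | hy
    · simpa [hσ0, Real.zero_rpow hlam.1.ne'] using tendsto_const_nhds
    · refine ((hL1 |y| (abs_pos.2 hy)).comp hd).congr' ?_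
      filter_upwards [hdpos] with u hu
      simp [abs_mul, abs_of_pos hu, mul_comm]
  have hxy : Tendsto (fun u => |x u - y|) l (𝓝 0) := by
    have := (hx.sub_const y).abs; simpa using this
  have h2 : Tendsto (fun u => C * |x u - y| ^ γ) l (𝓝 0) := by
    have := (hxy.rpow_const (p := γ) (Or.inr hγ.le)).const_mul C
    simpa [Real.zero_rpow hγ.ne'] using this
  have h3 : Tendsto (fun u => σ |d u * x u| / σ (d u) - σ |d u * y| / σ (d u)) l (𝓝 0) := by
    refine squeeze_zero_norm' ?_ h2
    filter_upwards [hdpos, hd0', hxy.eventually_le_const one_pos] with u hu1 hu2 hu3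
    have hs := hσpos _ hu1
    rw [Real.norm_eq_abs, ← sub_div, abs_div, abs_of_pos hs, div_le_iff₀ hs]
    refine le_trans ?_ (hpot (d u) (|x u - y|) hu1 hu2 (abs_nonneg _) hu3)
    have t1 := tri (d u * y) (d u * (x u - y))
    have t2 := tri (d u * x u) (-(d u * (x u - y)))
    rw [show d u * y + d u * (x u - y) = d u * x u by ring] at t1
    rw [show d u * x u + -(d u * (x u - y)) = d u * y by ring, abs_neg] at t2
    rw [abs_mul (d u) (x u - y), abs_of_pos hu1] at t1 t2
    rw [abs_le]; constructor <;> linarith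
  simpa using h3.add h1

lemma gcl_ratio_bdd {σ : ℝ → ℝ} (hσpos : ∀ t > (0:ℝ), 0 < σ t)
    {d0 C γ' : ℝ} (hd0 : 0 < d0) (hγ' : γ' ∈ Set.Ioo (0:ℝ) 1)
    (hpot : ∀ d x, 0 < d → 1 ≤ x → d * x ≤ d0 → σ (d * x) ≤ C * x ^ γ' * σ d)
    {ι : Type*} {l : Filter ι} {di dj ri rj : ι → ℝ} (hdi : Tendsto di l (𝓝[>] 0))
    (hdj : Tendsto dj l (𝓝[>] 0)) (hri : ∀ᶠ u in l, 0 < ri u)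
    (hi : ∀ᶠ u in l, ri u * di u = σ (di u)) (hj : ∀ᶠ u in l, rj u * dj u = σ (dj u))
    {a : ℝ} (ha : 0 < a) (hrr : ∀ᶠ u in l, a ≤ rj u / ri u) :
    ∃ M > (0:ℝ), ∀ᶠ u in l, dj u / di u ≤ M := by
  refine ⟨max 1 ((C / a) ^ (1 / (1 - γ'))), by positivity, ?_⟩
  filter_upwards [hdi self_mem_nhdsWithin, hdj self_mem_nhdsWithin, hri, hi, hj, hrr,
    (hdj.mono_right nhdsWithin_le_nhds).eventually_le_const hd0] with u h1 h2 h3 h4 h5 h6 h7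
  replace h1 : 0 < di u := h1
  replace h2 : 0 < dj u := h2
  have h1g : 0 < 1 - γ' := by linarith [hγ'.2]
  rcases le_total (dj u / di u) 1 with h | h
  · exact h.trans (le_max_left _ _)
  refine le_trans ?_ (le_max_right _ _)
  set q := dj u / di u with hq
  have hqpos : 0 < q := by positivity
  have hdq : di u * q = dj u := by rw [hq]; field_simp
  have h8 := hpot (di u) q h1 h (by rw [hdq]; exact h7)
  rw [hdq, ← h5, ← h4] at h8
  have h9 : rj u / ri u * q ≤ C * q ^ γ' := by
    have : rj u * dj u = (rj u / ri u * q) * (ri u * di u) := by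
      rw [← hdq]; field_simp
    rw [this] at h8
    exact le_of_mul_le_mul_right h8 (by positivity)
  have h10 : q ^ (1 - γ') ≤ C / a := by
    rw [le_div_iff₀ ha, Real.rpow_sub hqpos, Real.rpow_one, div_mul_eq_mul_div, div_le_iff₀ (by positivity)]
    calc q * a ≤ rj u / ri u * q := by rw [mul_comm]; gcongr
      _ ≤ _ := h9
  calc q = (q ^ (1 - γ')) ^ (1 / (1 - γ')) := by
        rw [← Real.rpow_mul hqpos.le, mul_one_div_cancel h1g.ne', Real.rpow_one]
    _ ≤ _ := by gcongr

lemma gcl_ratio_pos {σ : ℝ → ℝ} (hσ0 : σ 0 = 0)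
    (tri : ∀ a b : ℝ, σ |a + b| ≤ σ |a| + σ |b|)
    (hσpos : ∀ t > (0:ℝ), 0 < σ t)  {lam : ℝ} (hlam : lam ∈ Set.Ioo (0:ℝ) 1)
    (hL1 : ∀ t > (0:ℝ), Tendsto (fun x => σ (t * x) / σ x) (𝓝[>] 0) (𝓝 (t ^ lam)))
    {d0 C γ γ' : ℝ} (hd0 : 0 < d0) (hγ : 0 < γ) (hγ' : γ' ∈ Set.Ioo (0:ℝ) 1)
    (hpot1 : ∀ d x, 0 < d → d ≤ d0 → 0 ≤ x → x ≤ 1 → σ (d * x) ≤ C * x ^ γ * σ d)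
    (hpot : ∀ d x, 0 < d → 1 ≤ x → d * x ≤ d0 → σ (d * x) ≤ C * x ^ γ' * σ d)
    {ι : Type*} {l : Filter ι} {di dj ri rj : ι → ℝ} (hdi : Tendsto di l (𝓝[>] 0))
    (hdj : Tendsto dj l (𝓝[>] 0)) (hri : ∀ᶠ u in l, 0 < ri u) (hrj : ∀ᶠ u in l, 0 < rj u)
    (hi : ∀ᶠ u in l, ri u * di u = σ (di u)) (hj : ∀ᶠ u in l, rj u * dj u = σ (dj u))
    {ρ : ℝ} (hρ : 0 < ρ) (hrr : Tendsto (fun u => rj u / ri u) l (𝓝 ρ)) :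
    Tendsto (fun u => dj u / di u) l (𝓝 (ρ ^ (1 / (lam - 1)))) := by
  obtain ⟨M, hM, hMb⟩ := gcl_ratio_bdd hσpos hd0 hγ' hpot hdi hdj hri hi hj (half_pos hρ)
    (hrr.eventually_const_le (by linarith))
  have hrr' : Tendsto (fun u => ri u / rj u) l (𝓝 ρ⁻¹) := by
    refine (hrr.inv₀ hρ.ne').congr fun u => by simp
  have hρ' : 0 < ρ⁻¹ := by positivity
  obtain ⟨M', hM', hMb'⟩ := gcl_ratio_bdd hσpos hd0 hγ' hpot hdj hdi hrj hj hi (half_pos hρ')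
    (hrr'.eventually_const_le (by linarith))
  rw [tendsto_iff_ultrafilter]
  intro U hU
  have hmem : ∀ᶠ u in (U : Filter ι), dj u / di u ∈ Set.Icc M'⁻¹ M := by
    filter_upwards [hU hMb, hU hMb', hU (hdi self_mem_nhdsWithin), hU (hdj self_mem_nhdsWithin)] with u h1 h2 h3 h4
    replace h3 : 0 < di u := h3
    replace h4 : 0 < dj u := h4
    refine ⟨?_, h1⟩
    rw [inv_le_comm₀ hM' (by positivity), inv_div]
    exact h2
  obtain ⟨q, hq, hlim⟩ := (isCompact_Icc (a := M'⁻¹) (b := M)).ultrafilter_le_nhds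
    (U.map (fun u => dj u / di u)) (by rw [le_principal_iff]; exact hmem)
  have hlim : Tendsto (fun u => dj u / di u) U (𝓝 q) := hlim
  have hqpos : 0 < q := lt_of_lt_of_le (by positivity) hq.1
  suffices h : q = ρ ^ (1 / (lam - 1)) by rw [← h]; exact hlim
  have h1 := gcl_conv hσ0 tri hσpos hlam hL1 hd0 hγ hpot1 (hdi.mono_left hU) hlim
  have h2 : Tendsto (fun u => rj u / ri u * (dj u / di u)) U (𝓝 (ρ * q)) := (hrr.mono_left hU).mul hlim
  have h3 : ρ * q = |q| ^ lam := by
    refine tendsto_nhds_unique (h2.congr' ?_) h1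
    filter_upwards [hU (hdi self_mem_nhdsWithin), hU (hdj self_mem_nhdsWithin), hU hri, hU hi, hU hj] with u a1 a2 a3 a4 a5
    replace a1 : 0 < di u := a1
    replace a2 : 0 < dj u := a2
    rw [mul_div_cancel₀ _ a1.ne', abs_of_pos a2, ← a4, ← a5]
    field_simp
  rw [abs_of_pos hqpos] at h3
  have h4 : ρ = q ^ (lam - 1) := by
    rw [Real.rpow_sub hqpos, Real.rpow_one, ← h3]; field_simp
  have h5 : lam - 1 ≠ 0 := by linarith [hlam.2]
  rw [h4, ← Real.rpow_mul hqpos.le, mul_one_div_cancel h5, Real.rpow_one]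

lemma gcl_ratio_zero {σ : ℝ → ℝ} (hσpos : ∀ t > (0:ℝ), 0 < σ t)
    {d0 C γ γ' : ℝ} (hd0 : 0 < d0) (hC : 0 < C) (hγ : 0 < γ) (hγ' : γ' ∈ Set.Ioo (0:ℝ) 1)
    (hpot1 : ∀ d x, 0 < d → d ≤ d0 → 0 ≤ x → x ≤ 1 → σ (d * x) ≤ C * x ^ γ * σ d)
    (hpot : ∀ d x, 0 < d → 1 ≤ x → d * x ≤ d0 → σ (d * x) ≤ C * x ^ γ' * σ d)
    {ι : Type*} {l : Filter ι} {di dj ri rj : ι → ℝ} (hdi : Tendsto di l (𝓝[>] 0))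
    (hdj : Tendsto dj l (𝓝[>] 0)) (hri : ∀ᶠ u in l, 0 < ri u) (hrj : ∀ᶠ u in l, 0 < rj u)
    (hi : ∀ᶠ u in l, ri u * di u = σ (di u)) (hj : ∀ᶠ u in l, rj u * dj u = σ (dj u))
    (hrr : Tendsto (fun u => rj u / ri u) l (𝓝 0)) :
    Tendsto (fun u => di u / dj u) l (𝓝 0) := by
  have hb : Tendsto (fun u => C * (rj u / ri u)) l (𝓝 0) := by simpa using hrr.const_mul C
  refine squeeze_zero_norm' ?_ hb
  filter_upwards [hdi self_mem_nhdsWithin, hdj self_mem_nhdsWithin, hri, hi, hj, hrj,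
    (hdj.mono_right nhdsWithin_le_nhds).eventually_le_const hd0,
    (hdi.mono_right nhdsWithin_le_nhds).eventually_le_const hd0,
    hb.eventually_lt_const one_pos] with u h1 h2 h3 h4 h5 h6 h7 h7' h7''
  replace h1 : 0 < di u := h1
  replace h2 : 0 < dj u := h2
  set q := di u / dj u with hq
  have hqpos : 0 < q := by positivity
  have hdq : dj u * q = di u := by rw [hq]; field_simp
  have e1 : ri u * di u = (ri u / rj u * q) * (rj u * dj u) := by
      rw [← hdq]; field_simp
  rw [Real.norm_eq_abs, abs_of_pos hqpos]
  have hqle : q ≤ 1 := by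
    by_contra! hc
    have h8 := hpot (dj u) q h2 hc.le (by rw [hdq]; exact h7')
    rw [hdq, ← h5, ← h4, e1] at h8
    have h9 := le_of_mul_le_mul_right h8 (by positivity)
    have h10 : q ^ γ' ≤ q := by
      calc q ^ γ' ≤ q ^ (1:ℝ) := Real.rpow_le_rpow_of_exponent_le hc.le hγ'.2.le
        _ = q := by simp
    have h11 : ri u / rj u * q ≤ C * q := h9.trans (by gcongr)
    have h12 := le_of_mul_le_mul_right h11 hqpos
    rw [div_le_iff₀ h6] at h12
    rw [← mul_div_assoc, div_lt_one h3] at h7''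
    linarith
  have h8 := hpot1 (dj u) q h2 h7 hqpos.le hqle
  rw [hdq, ← h5, ← h4, e1] at h8
  have h9 := le_of_mul_le_mul_right h8 (by positivity)
  have h10 : q ^ γ ≤ 1 := Real.rpow_le_one hqpos.le hqle hγ.le
  have h11 : ri u / rj u * q ≤ C := h9.trans (mul_le_of_le_one_right hC.le h10)
  rw [div_mul_eq_mul_div, div_le_iff₀ h6] at h11
  rw [← mul_div_assoc, le_div_iff₀ h3]
  linarith

open scoped RealInnerProductSpace in
lemma gcl_norm_sub {σ : ℝ → ℝ} (hσ0 : σ 0 = 0) (hσpos : ∀ t > (0:ℝ), 0 < σ t)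
    {H : Type*} [NormedAddCommGroup H] [InnerProductSpace ℝ H] {j : ℝ → H}
    (hj : ∀ t s, ⟪j t, j s⟫ = covFromStd σ t s) (t s : ℝ) : ‖j t - j s‖ = σ |t - s| := by
  have hnn : 0 ≤ σ |t - s| := by
    rcases (abs_nonneg (t - s)).eq_or_lt with h | h
    · rw [← h, hσ0]
    · exact (hσpos _ h).le
  have : ‖j t - j s‖ ^ 2 = σ |t - s| ^ 2 := by
    rw [norm_sub_sq_real, ← real_inner_self_eq_norm_sq, ← real_inner_self_eq_norm_sq, hj, hj, hj]
    simp only [covFromStd, sub_self, abs_zero, hσ0]; ring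
  exact (pow_left_inj₀ (norm_nonneg _) hnn two_ne_zero).1 this

open scoped RealInnerProductSpace in
lemma gcl_norm {σ : ℝ → ℝ} (hσ0 : σ 0 = 0) (hσpos : ∀ t > (0:ℝ), 0 < σ t)
    {H : Type*} [NormedAddCommGroup H] [InnerProductSpace ℝ H] {j : ℝ → H}
    (hj : ∀ t s, ⟪j t, j s⟫ = covFromStd σ t s) : j 0 = 0 ∧ ∀ t, ‖j t‖ = σ |t| := by
  have h0 : j 0 = 0 := by
    have := hj 0 0
    rw [real_inner_self_eq_norm_sq] at this
    simpa [covFromStd, hσ0] using this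
  refine ⟨h0, fun t => ?_⟩
  have := gcl_norm_sub hσ0 hσpos hj t 0
  simpa [h0] using this

open scoped RealInnerProductSpace in
lemma gcl_tri {σ : ℝ → ℝ} (hσ0 : σ 0 = 0) (hσpos : ∀ t > (0:ℝ), 0 < σ t)
    {H : Type*} [NormedAddCommGroup H] [InnerProductSpace ℝ H] {j : ℝ → H}
    (hj : ∀ t s, ⟪j t, j s⟫ = covFromStd σ t s) (a b : ℝ) : σ |a + b| ≤ σ |a| + σ |b| := by
  have h1 := gcl_norm_sub hσ0 hσpos hj a (-b)
  have h2 := (gcl_norm hσ0 hσpos hj).2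
  have h3 := norm_sub_le (j a) (j (-b))
  rw [h1, h2, h2, abs_neg, sub_neg_eq_add] at h3
  exact h3

open scoped RealInnerProductSpace in
lemma gcl_indep_bound {σ : ℝ → ℝ} (hσ0 : σ 0 = 0) (hσpos : ∀ t > (0:ℝ), 0 < σ t)
    {H : Type*} [NormedAddCommGroup H] [InnerProductSpace ℝ H] {j : ℝ → H}
    (hj : ∀ t s, ⟪j t, j s⟫ = covFromStd σ t s) (N : ℕ) (a h : ℝ) :
    N * |covFromStd σ h a| ≤ σ |a| * σ |N * h| + ∑ k ∈ Finset.range N, 2 * σ |k * h| * σ |h| := by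
  obtain ⟨h0, hn⟩ := gcl_norm hσ0 hσpos hj
  have hs := gcl_norm_sub hσ0 hσpos hj
  have e : (N:ℝ) * covFromStd σ h a = ⟪j a, j (N * h)⟫ + 
      ∑ k ∈ Finset.range N, ⟪j (a + k * h) - j a - j (k * h), j ((k + 1 : ℕ) * h) - j (k * h)⟫ := by
    have e1 : j (N * h) = ∑ k ∈ Finset.range N, (j ((k + 1 : ℕ) * h) - j (k * h)) := by
      rw [Finset.sum_range_sub (fun k : ℕ => j (k * h))]; simp [h0]
    rw [e1, inner_sum, ← Finset.sum_add_distrib]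
    rw [Finset.sum_congr rfl (g := fun _ => covFromStd σ h a)]
    · simp
    · intro k _
      rw [← inner_add_left]
      rw [show j a + (j (a + k * h) - j a - j (k * h)) = j (a + k * h) - j (k * h) by abel]
      rw [inner_sub_left, inner_sub_right, inner_sub_right, hj, hj, hj, hj]
      simp only [covFromStd]
      push_cast
      rw [show a + k * h - (k + 1) * h = -(h - a) by ring, show a + k * h - k * h = a by ring,
        show k * h - (k+1) * h = -h by ring, sub_self, abs_neg, abs_neg, abs_zero, hσ0]
      ring
  have hN : (N:ℝ) * |covFromStd σ h a| = |(N:ℝ) * covFromStd σ h a| := by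
    rw [abs_mul, Nat.abs_cast]
  rw [hN, e]
  refine (abs_add_le _ _).trans (add_le_add ?_ ((Finset.abs_sum_le_sum_abs _ _).trans (Finset.sum_le_sum fun k _ => ?_)))
  · rw [← hn, ← hn]; exact abs_real_inner_le_norm _ _
  · refine (abs_real_inner_le_norm _ _).trans ?_
    have b1 : ‖j ((k + 1 : ℕ) * h) - j (k * h)‖ = σ |h| := by
      rw [hs]; congr 2; push_cast; ring
    have b2 : ‖j (a + k * h) - j a - j (k * h)‖ ≤ 2 * σ |k * h| := by
      refine (norm_sub_le _ _).trans ?_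
      rw [hs, hn, show a + k * h - a = k * h by ring]; linarith
    rw [b1]
    gcongr
    rw [← hn]; exact norm_nonneg _

open scoped RealInnerProductSpace in
lemma gcl_indep {σ : ℝ → ℝ} (hσ0 : σ 0 = 0)
    (hσpos : ∀ t > (0:ℝ), 0 < σ t)  {lam : ℝ} (hlam : lam ∈ Set.Ioo (0:ℝ) 1)
    (hL1 : ∀ t > (0:ℝ), Tendsto (fun x => σ (t * x) / σ x) (𝓝[>] 0) (𝓝 (t ^ lam)))
    {d0 C γ : ℝ} (hd0 : 0 < d0) (hγ : 0 < γ)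
    (hpot : ∀ d x, 0 < d → d ≤ d0 → 0 ≤ x → x ≤ 1 → σ (d * x) ≤ C * x ^ γ * σ d)
    {H : Type*} [NormedAddCommGroup H] [InnerProductSpace ℝ H] {j : ℝ → H}
    (hj : ∀ t s, ⟪j t, j s⟫ = covFromStd σ t s)
    {ι : Type*} {l : Filter ι} {e d : ι → ℝ} (he : Tendsto e l (𝓝[>] 0))
    (hd : Tendsto d l (𝓝[>] 0)) (hed : Tendsto (fun u => e u / d u) l (𝓝 0)) (t s : ℝ) :
    Tendsto (fun u => covFromStd σ (e u * t) (d u * s) / (σ (e u) * σ (d u))) l (𝓝 0) := by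
  have tri := gcl_tri hσ0 hσpos hj
  have conv : ∀ {d : ι → ℝ}, Tendsto d l (𝓝[>] 0) → ∀ x : ℝ, 
      Tendsto (fun u => σ |d u * x| / σ (d u)) l (𝓝 (|x| ^ lam)) := fun hd x =>
    gcl_conv hσ0 tri hσpos hlam hL1 hd0 hγ hpot hd tendsto_const_nhds
  have hsmall : Tendsto (fun u => σ (e u) / σ (d u)) l (𝓝 0) := by
    have := gcl_conv hσ0 tri hσpos hlam hL1 hd0 hγ hpot hd hed
    rw [abs_zero, Real.zero_rpow hlam.1.ne'] at this
    refine this.congr' ?_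
    filter_upwards [he self_mem_nhdsWithin, hd self_mem_nhdsWithin] with u h1 h2
    replace h1 : 0 < e u := h1
    replace h2 : 0 < d u := h2
    rw [mul_div_cancel₀ _ h2.ne', abs_of_pos h1]
  rw [Metric.tendsto_nhds]
  intro ε hε
  have hN : Tendsto (fun N : ℕ => |s| ^ lam * |t| ^ lam * (N:ℝ) ^ (-(1 - lam))) atTop (𝓝 0) := by
    have := ((tendsto_rpow_neg_atTop (y := 1 - lam) (by linarith [hlam.2])).comp 
      tendsto_natCast_atTop_atTop).const_mul (|s| ^ lam * |t| ^ lam)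
    simpa using this
  obtain ⟨N, hNε, hN1⟩ := ((hN.eventually_lt_const hε).and (eventually_ge_atTop 1)).exists
  have hNpos : (0:ℝ) < N := by exact_mod_cast hN1
  have hb : Tendsto (fun u => ((σ |d u * s| / σ (d u)) * (σ |e u * (N * t)| / σ (e u)) + 
      ∑ k ∈ Finset.range N, 2 * (σ |e u * (k * t)| / σ (e u)) * (σ |e u * t| / σ (e u)) * (σ (e u) / σ (d u))) / N) l
      (𝓝 ((|s| ^ lam * |N * t| ^ lam + ∑ k ∈ Finset.range N, 2 * |k * t| ^ lam * |t| ^ lam * 0) / N)) := by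
    refine Tendsto.div_const (Tendsto.add ((conv hd s).mul (conv he _)) (tendsto_finsetSum _ fun k _ => ?_)) _
    exact (((conv he _).const_mul 2).mul (conv he _)).mul hsmall
  have hlimeq : (|s| ^ lam * |N * t| ^ lam + ∑ k ∈ Finset.range N, 2 * |k * t| ^ lam * |t| ^ lam * 0) / N 
      = |s| ^ lam * |t| ^ lam * (N:ℝ) ^ (-(1 - lam)) := by
    rw [abs_mul, abs_of_pos hNpos, Real.mul_rpow hNpos.le (abs_nonneg _), neg_sub, Real.rpow_sub hNpos, Real.rpow_one]
    simp; ring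
  rw [hlimeq] at hb
  filter_upwards [hb.eventually_lt_const hNε, he self_mem_nhdsWithin, hd self_mem_nhdsWithin] with u h1 h2 h3
  replace h2 : 0 < e u := h2
  replace h3 : 0 < d u := h3
  have s2 := hσpos _ h2
  have s3 := hσpos _ h3
  rw [Real.dist_eq, sub_zero, abs_div, abs_of_pos (mul_pos s2 s3)]
  refine lt_of_le_of_lt ?_ h1
  have hb := gcl_indep_bound hσ0 hσpos hj N (d u * s) (e u * t)
  rw [div_le_div_iff₀ (by positivity) hNpos, mul_comm]
  refine hb.trans (le_of_eq ?_)
  rw [add_mul, Finset.sum_mul]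
  congr 1
  · rw [show (N:ℝ) * (e u * t) = e u * (N * t) by ring]; field_simp
  · refine Finset.sum_congr rfl fun k _ => ?_
    rw [show (k:ℝ) * (e u * t) = e u * (k * t) by ring]; field_simp

lemma gcl_delta {σ : ℝ → ℝ} (hσcont : ContinuousOn σ (Set.Ici 0))
    {t₀ β C : ℝ} (ht₀ : 0 < t₀) (hβ : β ∈ Set.Ioo (0:ℝ) 1) (hC : 0 < C)
    (hL2 : ∀ t > t₀, σ t ≤ C * t ^ β)
    {δ : ℝ → ℝ} (hδ : ∀ᶠ x in atTop, 0 < δ x ∧ x * δ x = σ (δ x)) :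
    Tendsto δ atTop (𝓝[>] 0) := by
  rw [tendsto_nhdsWithin_iff]
  refine ⟨?_, hδ.mono fun x hx => hx.1⟩
  rw [Metric.tendsto_nhds]
  intro ε hε
  obtain ⟨M, hM⟩ : ∃ M : ℝ, ∀ t ∈ Set.Icc ε t₀, σ t ≤ M := by
    have := (isCompact_Icc (a := ε) (b := t₀)).bddAbove_image (f := σ) 
      (hσcont.mono fun x hx => hε.le.trans hx.1)
    obtain ⟨M, hM⟩ := this
    exact ⟨M, fun t ht => hM ⟨t, ht, rfl⟩⟩
  filter_upwards [hδ, eventually_gt_atTop (|M| / ε), eventually_gt_atTop (C * t₀ ^ (β - 1))] with x h1 h2 h3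
  obtain ⟨hp, he⟩ := h1
  rw [Real.dist_eq, sub_zero, abs_of_pos hp]
  by_contra! hc
  rcases le_or_gt (δ x) t₀ with h | h
  · have := hM (δ x) ⟨hc, h⟩
    rw [div_lt_iff₀ hε] at h2
    have hx : 0 ≤ x := by
      by_contra! hx
      nlinarith [abs_nonneg M]
    have : x * ε ≤ x * δ x := by gcongr
    linarith [le_abs_self M]
  · have h4 := hL2 _ h
    have h5 : δ x ^ (β - 1) ≤ t₀ ^ (β - 1) :=
      Real.rpow_le_rpow_of_nonpos ht₀ h.le (by linarith [hβ.2])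
    have h6 : δ x ^ β = δ x ^ (β - 1) * δ x := by
      rw [Real.rpow_sub hp, Real.rpow_one]; field_simp
    rw [← he, h6, ← mul_assoc] at h4
    have h7 := le_of_mul_le_mul_right h4 hp
    have : C * δ x ^ (β - 1) ≤ C * t₀ ^ (β - 1) := by gcongr
    linarith

lemma gcl_limCov {σ : ℝ → ℝ} (hσ0 : σ 0 = 0)
    (tri : ∀ a b : ℝ, σ |a + b| ≤ σ |a| + σ |b|)
    (hσpos : ∀ t > (0:ℝ), 0 < σ t)  {lam : ℝ} (hlam : lam ∈ Set.Ioo (0:ℝ) 1)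
    (hL1 : ∀ t > (0:ℝ), Tendsto (fun x => σ (t * x) / σ x) (𝓝[>] 0) (𝓝 (t ^ lam)))
    {d0 C γ : ℝ} (hd0 : 0 < d0) (hγ : 0 < γ)
    (hpot : ∀ d x, 0 < d → d ≤ d0 → 0 ≤ x → x ≤ 1 → σ (d * x) ≤ C * x ^ γ * σ d)
    {ι : Type*} {l : Filter ι} {d e : ι → ℝ} {ρ : ℝ} (hρ : 0 < ρ) (hd : Tendsto d l (𝓝[>] 0))
    (he : Tendsto e l (𝓝[>] 0))
    (hq : Tendsto (fun u => e u / d u) l (𝓝 (ρ ^ (1 / (lam - 1))))) (t s : ℝ) :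
    Tendsto (fun u => covFromStd σ (d u * t) (e u * s) / (σ (d u) * σ (e u))) l
      (𝓝 (limCov lam ρ t s)) := by
  have conv : ∀ {x : ι → ℝ} {y : ℝ}, Tendsto x l (𝓝 y) → 
      Tendsto (fun u => σ |d u * x u| / σ (d u)) l (𝓝 (|y| ^ lam)) := fun hx =>
    gcl_conv hσ0 tri hσpos hlam hL1 hd0 hγ hpot hd hx
  have hqpos : 0 < ρ ^ (1 / (lam - 1)) := by positivity
  set Q := ρ ^ (1 / (lam - 1)) with hQ
  have h1 := ((((conv (tendsto_const_nhds (x := t))).pow 2).add ((conv (hq.mul_const s)).pow 2)).sub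
    ((conv ((tendsto_const_nhds (x := t)).sub (hq.mul_const s))).pow 2)).div
    ((conv hq).const_mul 2) (by positivity)
  have e1 : ∀ x : ℝ, (|x| ^ lam) ^ 2 = |x| ^ (2 * lam) := by
    intro x
    rw [← Real.rpow_natCast, ← Real.rpow_mul (abs_nonneg _)]; congr 1; push_cast; ring
  have e2 : limCov lam ρ t s = ((|t| ^ lam) ^ 2 + (|Q * s| ^ lam) ^ 2 - (|t - Q * s| ^ lam) ^ 2) / (2 * |Q| ^ lam) := by
    rw [limCov, if_pos hρ, e1, e1, e1, abs_of_pos hqpos, Real.rpow_mul hρ.le]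
  rw [e2]
  refine h1.congr' ?_
  filter_upwards [hd self_mem_nhdsWithin, he self_mem_nhdsWithin] with u a1 a2
  replace a1 : 0 < d u := a1
  replace a2 : 0 < e u := a2
  have s1 := hσpos _ a1
  have s2 := hσpos _ a2
  have b1 : d u * (e u / d u) = e u := by field_simp
  have b2 : d u * (e u / d u * s) = e u * s := by field_simp
  have b3 : d u * (t - e u / d u * s) = d u * t - e u * s := by field_simp
  simp only [Pi.div_apply, b1, b2, b3, abs_of_pos a2, covFromStd]
  field_simp

lemma gcl_memLp {Ω : Type*} [MeasurableSpace Ω] {P : Measure Ω} {X : Ω → ℝ} (hX : Measurable X)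
    {v : NNReal} (h : P.map X = gaussianReal 0 v) : MemLp X 2 P := by
  have h1 : MemLp (id : ℝ → ℝ) 2 (P.map X) := by
    rw [h]; exact memLp_id_gaussianReal 2
  exact (memLp_map_measure_iff (by fun_prop) hX.aemeasurable).1 h1

lemma gcl_sq_int {Ω : Type*} [MeasurableSpace Ω] {P : Measure Ω} {X : Ω → ℝ} (hX : Measurable X)
    {v : NNReal} (h : P.map X = gaussianReal 0 v) : ∫ ω, X ω ^ 2 ∂P = v := by
  have h1 : ∫ x, x ^ 2 ∂(P.map X) = ∫ ω, X ω ^ 2 ∂P := 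
    integral_map hX.aemeasurable (by fun_prop)
  rw [← h1, h]
  have h2 := variance_id_gaussianReal (μ := 0) (v := v)
  rw [variance_eq_integral (by fun_prop)] at h2
  simpa using h2

open scoped RealInnerProductSpace in
lemma gcl_hilbert {Ω : Type*} [MeasurableSpace Ω] (P : Measure Ω) {σ : ℝ → ℝ} (hσ0 : σ 0 = 0)
    {J : ℝ → Ω → ℝ} (hJ : IsCenteredGaussian1 P J (covFromStd σ)) :
    ∃ j : ℝ → Lp ℝ 2 P, ∀ t s, ⟪j t, j s⟫ = covFromStd σ t s := by
  obtain ⟨hm, hg⟩ := hJ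
  have g1 : ∀ t, P.map (J t) = gaussianReal 0 (σ |t| ^ 2).toNNReal := by
    intro t
    have := hg 1 (fun _ => t) (fun _ => 1)
    simp only [Finset.univ_unique, Finset.sum_singleton, one_mul] at this
    rw [this]; congr 2; simp [covFromStd, hσ0]
  have g2 : ∀ t s, P.map (fun ω => J t ω - J s ω) = gaussianReal 0 (σ |t - s| ^ 2).toNNReal := by
    intro t s
    have := hg 2 ![t, s] ![1, -1]
    simp only [Fin.sum_univ_two] at this
    simp only [Matrix.cons_val_zero, Matrix.cons_val_one, one_mul, neg_mul, ← sub_eq_add_neg] at this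
    rw [this]; congr 2; simp [covFromStd, hσ0, abs_sub_comm s t]; ring
  have hL : ∀ t, MemLp (J t) 2 P := fun t => gcl_memLp (hm t) (g1 t)
  refine ⟨fun t => (hL t).toLp, fun t s => ?_⟩
  have e : ⟪(hL t).toLp, (hL s).toLp⟫ = ∫ ω, J t ω * J s ω ∂P := by
    rw [L2.inner_def]
    refine integral_congr_ae ?_
    filter_upwards [(hL t).coeFn_toLp, (hL s).coeFn_toLp] with ω h1 h2
    rw [h1, h2]; simp [mul_comm]
  rw [e]
  have i1 := gcl_sq_int (hm t) (g1 t)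
  have i2 := gcl_sq_int (hm s) (g1 s)
  have i3 := gcl_sq_int ((hm t).sub (hm s)) (g2 t s)
  rw [Real.coe_toNNReal _ (sq_nonneg _)] at i1 i2 i3
  have e2 : ∀ ω, J t ω * J s ω = (J t ω ^ 2 + J s ω ^ 2 - (J t - J s) ω ^ 2) / 2 := by
    intro ω; simp only [Pi.sub_apply]; ring
  simp_rw [e2]
  have hI : Integrable (fun ω => J t ω ^ 2 + J s ω ^ 2) P := 
    (hL t).integrable_sq.add (hL s).integrable_sq
  rw [integral_div, integral_sub hI ((hL t).sub (hL s)).integrable_sq,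
    integral_add (hL t).integrable_sq (hL s).integrable_sq, i1, i2, i3]
  rfl

lemma gcl_gauss_fintype {Ω : Type*} [MeasurableSpace Ω] {P : Measure Ω} {K : ℝ → ℝ → ℝ}
    {J : ℝ → Ω → ℝ} (hJ : IsCenteredGaussian1 P J K) {κ : Type*} [Fintype κ] (t c : κ → ℝ) :
    P.map (fun ω => ∑ a, c a * J (t a) ω)
      = gaussianReal 0 (∑ a, ∑ b, c a * c b * K (t a) (t b)).toNNReal := by
  let e := (Fintype.equivFin κ).symm
  have h := hJ.2 (Fintype.card κ) (t ∘ e) (c ∘ e)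
  have h1 : ∀ ω, ∑ a, c a * J (t a) ω = ∑ a, (c ∘ e) a * J ((t ∘ e) a) ω := fun ω =>
    (Equiv.sum_comp e (fun a => c a * J (t a) ω)).symm
  have h2 : ∑ a, ∑ b, c a * c b * K (t a) (t b) = 
      ∑ a, ∑ b, (c ∘ e) a * (c ∘ e) b * K ((t ∘ e) a) ((t ∘ e) b) := by
    rw [← Equiv.sum_comp e]
    refine Finset.sum_congr rfl fun a _ => ?_
    rw [← Equiv.sum_comp e]; rfl
  simp_rw [h1, h2]; exact h

lemma gcl_charFun {Ω : Type*} [MeasurableSpace Ω] {P : Measure Ω} {ι : Type*} [Fintype ι]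
    {V : Ω → ι → ℝ} (hV : ∀ i, Measurable fun ω => V ω i) (w : EuclideanSpace ℝ ι) {v : NNReal}
    (h : P.map (fun ω => ∑ i, w i * V ω i) = gaussianReal 0 v) :
    charFun (P.map fun ω => (WithLp.toLp 2 (V ω) : EuclideanSpace ℝ ι)) w = 
      Complex.exp (-(v : ℝ) / 2 : ℝ) := by
  have hm : Measurable fun ω => (WithLp.toLp 2 (V ω) : EuclideanSpace ℝ ι) :=
    (WithLp.measurable_toLp 2 _).comp (measurable_pi_iff.2 hV)
  have h1 := charFun_gaussianReal (μ := 0) (v := v) 1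
  have hs : Measurable fun ω => ∑ i, w i * V ω i := 
    Finset.measurable_sum _ fun i _ => (hV i).const_mul _
  rw [← h, charFun_apply, integral_map hs.aemeasurable (by fun_prop)] at h1
  rw [charFun_apply, integral_map hm.aemeasurable (by fun_prop)]
  have h2 : ∀ ω, inner ℝ (WithLp.toLp 2 (V ω) : EuclideanSpace ℝ ι) w = inner ℝ (∑ i, w i * V ω i) (1:ℝ) := by
    intro ω; simp [PiLp.inner_apply]
  simp_rw [h2]
  rw [h1]; congr 1; push_cast; ring

lemma gcl_fdd {Ω Ω' : Type*} [MeasurableSpace Ω] [MeasurableSpace Ω']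
    (P : Measure Ω) (P' : Measure Ω') [IsProbabilityMeasure P] [IsProbabilityMeasure P']
    {ι : Type*} [Fintype ι] {V : ℕ → Ω → ι → ℝ} {W : Ω' → ι → ℝ}
    (hV : ∀ k i, Measurable fun ω => V k ω i) (hW : ∀ i, Measurable fun ω => W ω i)
    (v : ℕ → (ι → ℝ) → NNReal) (v' : (ι → ℝ) → NNReal)
    (h1 : ∀ᶠ k in atTop, ∀ c : ι → ℝ, P.map (fun ω => ∑ i, c i * V k ω i) = gaussianReal 0 (v k c))
    (h2 : ∀ c : ι → ℝ, P'.map (fun ω => ∑ i, c i * W ω i) = gaussianReal 0 (v' c))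
    (h3 : ∀ c, Tendsto (fun k => v k c) atTop (𝓝 (v' c)))
    (G : BoundedContinuousFunction (ι → ℝ) ℝ) :
    Tendsto (fun k => ∫ ω, G (V k ω) ∂P) atTop (𝓝 (∫ ω, G (W ω) ∂P')) := by
  have hm : ∀ k, Measurable fun ω => (WithLp.toLp 2 (V k ω) : EuclideanSpace ℝ ι) := fun k =>
    (WithLp.measurable_toLp 2 _).comp (measurable_pi_iff.2 (hV k))
  have hm' : Measurable fun ω => (WithLp.toLp 2 (W ω) : EuclideanSpace ℝ ι) :=
    (WithLp.measurable_toLp 2 _).comp (measurable_pi_iff.2 hW)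
  let μ : ℕ → ProbabilityMeasure (EuclideanSpace ℝ ι) := fun k => 
    ⟨P.map fun ω => (WithLp.toLp 2 (V k ω)), Measure.isProbabilityMeasure_map (hm k).aemeasurable⟩
  let μ' : ProbabilityMeasure (EuclideanSpace ℝ ι) := 
    ⟨P'.map fun ω => (WithLp.toLp 2 (W ω)), Measure.isProbabilityMeasure_map hm'.aemeasurable⟩
  have ht : Tendsto μ atTop (𝓝 μ') := by
    apply ProbabilityMeasure.tendsto_of_tendsto_charFun
    intro w
    have e2 : charFun (μ' : Measure (EuclideanSpace ℝ ι)) w = _ := gcl_charFun hW w (h2 w)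
    rw [e2]
    have e3 : Tendsto (fun k => Complex.exp (-(v k w : ℝ) / 2 : ℝ)) atTop 
        (𝓝 (Complex.exp (-(v' w : ℝ) / 2 : ℝ))) := by
      have : Tendsto (fun k => (v k w : ℝ)) atTop (𝓝 (v' w : ℝ)) := 
        NNReal.tendsto_coe.2 (h3 w)
      exact (Complex.continuous_exp.tendsto _).comp 
        ((Complex.continuous_ofReal.tendsto _).comp ((this.neg).div_const 2))
    refine e3.congr' ?_
    filter_upwards [h1] with k hk
    exact (gcl_charFun (hV k) w (hk w)).symm
  rw [ProbabilityMeasure.tendsto_iff_forall_integral_tendsto] at ht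
  let G' : BoundedContinuousFunction (EuclideanSpace ℝ ι) ℝ := 
    G.compContinuous ⟨WithLp.ofLp, PiLp.continuous_ofLp 2 _⟩
  have := ht G'
  have c1 : ∀ k, ∫ x, G' x ∂(μ k : Measure (EuclideanSpace ℝ ι)) = ∫ ω, G (V k ω) ∂P := fun k =>
    integral_map (hm k).aemeasurable (by fun_prop)
  have c2 : ∫ x, G' x ∂(μ' : Measure (EuclideanSpace ℝ ι)) = ∫ ω, G (W ω) ∂P' :=
    integral_map hm'.aemeasurable (by fun_prop)
  simp_rw [c1, c2] at this
  exact this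

lemma gcl_cov_symm (σ : ℝ → ℝ) (t s : ℝ) : covFromStd σ t s = covFromStd σ s t := by
  simp only [covFromStd, abs_sub_comm t s]; ring

open scoped RealInnerProductSpace in
lemma gcl_covMat {σ : ℝ → ℝ} (hσ0 : σ 0 = 0)
    (hσpos : ∀ t > (0:ℝ), 0 < σ t) {lam : ℝ} (hlam : lam ∈ Set.Ioo (0:ℝ) 1)
    (hL1 : ∀ t > (0:ℝ), Tendsto (fun x => σ (t * x) / σ x) (𝓝[>] 0) (𝓝 (t ^ lam)))
    {d0 C γ γ' : ℝ} (hd0 : 0 < d0) (hC : 0 < C) (hγ : 0 < γ) (hγ' : γ' ∈ Set.Ioo (0:ℝ) 1)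
    (hpot1 : ∀ d x, 0 < d → d ≤ d0 → 0 ≤ x → x ≤ 1 → σ (d * x) ≤ C * x ^ γ * σ d)
    (hpot : ∀ d x, 0 < d → 1 ≤ x → d * x ≤ d0 → σ (d * x) ≤ C * x ^ γ' * σ d)
    {H : Type*} [NormedAddCommGroup H] [InnerProductSpace ℝ H] {j : ℝ → H}
    (hj : ∀ t s, ⟪j t, j s⟫ = covFromStd σ t s)
    {n : ℕ} {ι : Type*} {l : Filter ι} {r d : Fin n → ι → ℝ}
    (hd : ∀ i, Tendsto (d i) l (𝓝[>] 0)) (hr : ∀ i, ∀ᶠ u in l, 0 < r i u)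
    (he : ∀ i, ∀ᶠ u in l, r i u * d i u = σ (d i u))
    {ρ : Fin n → Fin n → ℝ}
    (hρmem : ∀ i j, i ≤ j → ρ i j ∈ Set.Icc (0:ℝ) 1)
    (hN3 : ∀ i j, i ≤ j → Tendsto (fun u => r j u / r i u) l (𝓝 (ρ i j)))
    (i k : Fin n) (t s : ℝ) :
    Tendsto (fun u => covFromStd σ (d i u * t) (d k u * s) / (σ (d i u) * σ (d k u))) l
      (𝓝 (limCovMat lam ρ i k t s)) := by
  have tri := gcl_tri hσ0 hσpos hj
  have main : ∀ (i k : Fin n) (t s : ℝ), i ≤ k → 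
      Tendsto (fun u => covFromStd σ (d i u * t) (d k u * s) / (σ (d i u) * σ (d k u))) l
      (𝓝 (limCov lam (ρ i k) t s)) := by
    intro i k t s hik
    rcases (hρmem i k hik).1.eq_or_lt with h | h
    · have h3 := hN3 i k hik
      rw [← h] at h3
      have h4 := gcl_ratio_zero hσpos hd0 hC hγ hγ' hpot1 hpot (hd i) (hd k) (hr i) (hr k) 
        (he i) (he k) h3
      have h5 := gcl_indep hσ0 hσpos hlam hL1 hd0 hγ hpot1 hj (hd i) (hd k) h4 t s
      have : limCov lam (ρ i k) t s = 0 := by simp [limCov, ← h]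
      rw [this]; exact h5
    · have h4 := gcl_ratio_pos hσ0 tri hσpos hlam hL1 hd0 hγ hγ' hpot1 hpot (hd i) (hd k) (hr i) 
        (hr k) (he i) (he k) h (hN3 i k hik)
      exact gcl_limCov hσ0 tri hσpos hlam hL1 hd0 hγ hpot1 h (hd i) (hd k) h4 t s
  rcases le_or_gt i k with h | h
  · simp only [limCovMat, h, if_true]; exact main i k t s h
  · simp only [limCovMat, not_le.2 h, if_false]
    refine (main k i s t h.le).congr fun u => ?_
    rw [gcl_cov_symm, mul_comm (σ (d k u))]

lemma gcl_quad {n K : ℕ} (c : Fin K × Fin n → ℝ) 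
    (M : Fin n → Fin n → Fin K → Fin K → ℝ) :
    ∑ x, ∑ y, c x * c y * M x.2 y.2 x.1 y.1 = 
      ∑ a, ∑ b, ∑ i, ∑ j, c (a, i) * c (b, j) * M i j a b := by
  simp only [Fintype.sum_prod_type]
  refine Finset.sum_congr rfl fun a _ => ?_
  rw [Finset.sum_comm]

/-- convergence of the finite dimensional distributions -/
lemma gcl_fdd_app {Ω Ω' : Type*} [MeasurableSpace Ω] [MeasurableSpace Ω']
    (P : Measure Ω) (P' : Measure Ω') [IsProbabilityMeasure P] [IsProbabilityMeasure P']
    {n : ℕ} {σ : ℝ → ℝ} {J : ℝ → Ω → ℝ} 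
    (hJ : IsCenteredGaussian1 P J (covFromStd σ))
    {L : Fin n → Fin n → ℝ → ℝ → ℝ} {B : ℝ → Ω' → Fin n → ℝ} 
    (hB : IsCenteredGaussianVec P' B L)
    {d : Fin n → ℕ → ℝ}
    (hlim : ∀ i k t s, Tendsto (fun u => covFromStd σ (d i u * t) (d k u * s) / (σ (d i u) * σ (d k u))) 
      atTop (𝓝 (L i k t s)))
    {K : ℕ} (t : Fin K → ℝ)
    (G : BoundedContinuousFunction (Fin K × Fin n → ℝ) ℝ) :
    Tendsto (fun k => ∫ ω, G (fun x => J (d x.2 k * t x.1) ω / σ (d x.2 k)) ∂P) atTop 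
      (𝓝 (∫ ω, G (fun x => B (t x.1) ω x.2) ∂P')) := by
  refine gcl_fdd P P' (V := fun k ω x => J (d x.2 k * t x.1) ω / σ (d x.2 k)) 
    (W := fun ω x => B (t x.1) ω x.2) (fun k x => (hJ.1 _).div_const _) (fun x => hB.1 _ _)
    (fun k c => (∑ x, ∑ y, c x * c y * 
      (covFromStd σ (d x.2 k * t x.1) (d y.2 k * t y.1) / (σ (d x.2 k) * σ (d y.2 k)))).toNNReal)
    (fun c => (∑ x, ∑ y, c x * c y * L x.2 y.2 (t x.1) (t y.1)).toNNReal) ?_ ?_ ?_ G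
  · refine Eventually.of_forall fun k c => ?_
    have := gcl_gauss_fintype hJ (fun x : Fin K × Fin n => d x.2 k * t x.1) 
      (fun x => c x / σ (d x.2 k))
    convert this using 4
    · ring
    · refine Finset.sum_congr rfl fun y _ => ?_
      simp only [div_eq_mul_inv, mul_inv]; ring
  · intro c
    have := hB.2 K t (fun a i => c (a, i))
    rw [gcl_quad c (fun i j a b => L i j (t a) (t b)), ← this]
    simp only [Fintype.sum_prod_type]
  · intro c
    refine (continuous_real_toNNReal.tendsto _).comp ?_
    exact tendsto_finsetSum _ fun x _ => tendsto_finsetSum _ fun y _ => 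
      (hlim _ _ _ _).const_mul _

lemma gcl_gauss_tail (p : ℕ) : ∃ M : ℝ, 0 ≤ M ∧ ∀ (v : NNReal) (s b : ℝ), 0 < s → 0 < b → 
    Real.sqrt v ≤ s → gaussianReal 0 v {x | b < |x|} ≤ ENNReal.ofReal (M * (s / b) ^ p) := by
  refine ⟨∫ x, |x| ^ p ∂(gaussianReal 0 1), integral_nonneg fun x => by positivity, ?_⟩
  intro v s b hs hb hv
  have e : gaussianReal 0 v = (gaussianReal 0 1).map (fun x => Real.sqrt v * x) := by
    rw [gaussianReal_map_const_mul]
    congr 1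
    · simp
    · ext; simp
  have hmeas : MeasurableSet {x : ℝ | b < |x|} := measurableSet_lt measurable_const (by fun_prop)
  have hint : Integrable (fun x : ℝ => |x| ^ p) (gaussianReal 0 1) := by
    have := (memLp_id_gaussianReal (μ := 0) (v := 1) p).integrable_norm_pow'
    simpa using this
  have h1 := mul_meas_ge_le_integral_of_nonneg (μ := gaussianReal 0 1) (f := fun x : ℝ => |x| ^ p)
    (Eventually.of_forall fun x => by positivity) hint ((b / s) ^ p)
  rw [e, Measure.map_apply (by fun_prop) hmeas]
  have h2 : (fun x => Real.sqrt v * x) ⁻¹' {x | b < |x|} ⊆ {x : ℝ | (b / s) ^ p ≤ |x| ^ p} := by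
    intro x hx
    simp only [Set.mem_preimage, Set.mem_ofPred_eq, abs_mul, abs_of_nonneg (Real.sqrt_nonneg _)] at hx ⊢
    apply pow_le_pow_left₀ (by positivity)
    rw [div_le_iff₀ hs]
    nlinarith [abs_nonneg x, mul_le_mul_of_nonneg_right hv (abs_nonneg x)]
  have hbp : 0 < (b / s) ^ p := by positivity
  refine (measure_mono h2).trans ?_
  rw [← ofReal_measureReal]
  apply ENNReal.ofReal_le_ofReal
  rw [← inv_div b s, inv_pow, ← div_eq_mul_inv, le_div_iff₀ hbp, mul_comm]
  exact h1

lemma gcl_tight {Ω : Type*} [MeasurableSpace Ω] (P : Measure Ω) {r C : ℝ} (hr0 : 0 < r) (hr1 : r < 1)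
    (hC : 0 < C) (N : ℕ) : ∃ D : ℝ, ∀ X : ℝ → Ω → ℝ, (∀ t, Measurable (X t)) → 
    (∀ (k : ℕ) (j : ℤ), ∃ v : NNReal, P.map (fun ω => X ((j + 1) / 2 ^ k) ω - X (j / 2 ^ k) ω) 
      = gaussianReal 0 v ∧ Real.sqrt v ≤ C * (r ^ 2) ^ k) → ∀ m : ℕ,
    P {ω | ¬ ∀ k, m ≤ k → ∀ j : ℤ, |j| ≤ N * 2 ^ k → 
      |X ((j + 1) / 2 ^ k) ω - X (j / 2 ^ k) ω| ≤ r ^ k} ≤ ENNReal.ofReal (D * (1 / 2) ^ m) := by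
  obtain ⟨p, hp⟩ := exists_pow_lt_of_lt_one (show (0:ℝ) < 1 / 4 by norm_num) hr1
  obtain ⟨M, hM, htail⟩ := gcl_gauss_tail p
  refine ⟨(2 * N + 1) * (M * C ^ p) * 2, fun X hX hv m => ?_⟩
  have h1 : ∀ (k : ℕ) (j : ℤ), P {ω | ¬ |X ((j + 1) / 2 ^ k) ω - X (j / 2 ^ k) ω| ≤ r ^ k} ≤ 
      ENNReal.ofReal (M * C ^ p * (1 / 4) ^ k) := by
    intro k j
    obtain ⟨v, hv1, hv2⟩ := hv k j
    have h := htail v (C * (r ^ 2) ^ k) (r ^ k) (by positivity) (by positivity) hv2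
    have hms : Measurable (fun ω => X ((j + 1) / 2 ^ k) ω - X (j / 2 ^ k) ω) := (hX _).sub (hX _)
    have hset : MeasurableSet {x : ℝ | r ^ k < |x|} := measurableSet_lt measurable_const (by fun_prop)
    rw [← hv1, Measure.map_apply hms hset] at h
    simp only [not_le]
    refine h.trans (ENNReal.ofReal_le_ofReal ?_)
    have : C * (r ^ 2) ^ k / r ^ k = C * r ^ k := by
      rw [← pow_mul, mul_comm 2 k, pow_mul]; field_simp
    rw [this, mul_pow, ← pow_mul, mul_comm k p, pow_mul, mul_assoc]
    gcongr
  have h2 : ∀ k : ℕ, P {ω | ¬ ∀ j : ℤ, |j| ≤ N * 2 ^ k → 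
      |X ((j + 1) / 2 ^ k) ω - X (j / 2 ^ k) ω| ≤ r ^ k} ≤ 
      ENNReal.ofReal ((2 * N + 1) * (M * C ^ p) * (1 / 2) ^ k) := by
    intro k
    have hsub : {ω | ¬ ∀ j : ℤ, |j| ≤ N * 2 ^ k → |X ((j + 1) / 2 ^ k) ω - X (j / 2 ^ k) ω| ≤ r ^ k} ⊆ 
        ⋃ j ∈ Finset.Icc (-(N * 2 ^ k : ℤ)) (N * 2 ^ k), 
          {ω | ¬ |X ((j + 1) / 2 ^ k) ω - X (j / 2 ^ k) ω| ≤ r ^ k} := by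
      intro ω hω
      simp only [Set.mem_ofPred_eq, not_forall] at hω
      obtain ⟨j, hj, hj2⟩ := hω
      simp only [Set.mem_iUnion, Finset.mem_Icc]
      exact ⟨j, abs_le.1 hj, hj2⟩
    refine (measure_mono hsub).trans ((measure_biUnion_finset_le _ _).trans ?_)
    refine (Finset.sum_le_sum fun j _ => h1 k j).trans ?_
    rw [Finset.sum_const, nsmul_eq_mul, Int.card_Icc, ← ENNReal.ofReal_natCast, 
      ← ENNReal.ofReal_mul (by positivity)]
    apply ENNReal.ofReal_le_ofReal
    have hc : (((N * 2 ^ k + 1 - -(N * 2 ^ k : ℤ)).toNat : ℕ) : ℝ) = 2 * N * 2 ^ k + 1 := by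
      have : (N * 2 ^ k + 1 - -(N * 2 ^ k : ℤ)).toNat = 2 * N * 2 ^ k + 1 := by
        have h0 : (N * 2 ^ k + 1 - -(N * 2 ^ k : ℤ)) = ((2 * N * 2 ^ k + 1 : ℕ) : ℤ) := by
          push_cast; ring
        rw [h0, Int.toNat_natCast]
      rw [this]; push_cast; ring
    rw [hc]
    have h3 : (1 / 4 : ℝ) ^ k = (1 / 2) ^ k * (1 / 2) ^ k := by rw [← mul_pow]; norm_num
    have h4 : (2 * N * 2 ^ k + 1 : ℝ) * (1 / 2) ^ k ≤ 2 * N + 1 := by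
      have h5 : (2:ℝ) ^ k * (1 / 2) ^ k = 1 := by rw [← mul_pow]; norm_num
      have h6 : (1 / 2 : ℝ) ^ k ≤ 1 := pow_le_one₀ (by norm_num) (by norm_num)
      nlinarith
    rw [h3]
    calc (2 * N * 2 ^ k + 1 : ℝ) * (M * C ^ p * ((1 / 2) ^ k * (1 / 2) ^ k)) 
        = ((2 * N * 2 ^ k + 1 : ℝ) * (1 / 2) ^ k) * (M * C ^ p * (1 / 2) ^ k) := by ring
      _ ≤ (2 * N + 1) * (M * C ^ p * (1 / 2) ^ k) := by gcongr
      _ = _ := by ring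
  have hsub : {ω | ¬ ∀ k, m ≤ k → ∀ j : ℤ, |j| ≤ N * 2 ^ k → 
      |X ((j + 1) / 2 ^ k) ω - X (j / 2 ^ k) ω| ≤ r ^ k} ⊆ 
      ⋃ k : ℕ, {ω | ¬ ∀ j : ℤ, |j| ≤ N * 2 ^ (m + k) → 
      |X ((j + 1) / 2 ^ (m + k)) ω - X (j / 2 ^ (m + k)) ω| ≤ r ^ (m + k)} := by
    intro ω hω
    rw [Set.mem_ofPred_eq, not_forall] at hω
    obtain ⟨k, hk⟩ := hω
    rw [Classical.not_imp] at hk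
    rw [Set.mem_iUnion]
    refine ⟨k - m, ?_⟩
    rw [Nat.add_sub_cancel' hk.1]
    exact hk.2
  refine (measure_mono hsub).trans ((measure_iUnion_le _).trans ?_)
  refine (ENNReal.tsum_le_tsum fun k => h2 (m + k)).trans ?_
  have e : ∀ k : ℕ, (2 * N + 1 : ℝ) * (M * C ^ p) * (1 / 2) ^ (m + k) = 
    ((2 * N + 1 : ℝ) * (M * C ^ p) * (1 / 2) ^ m) * (1 / 2) ^ k := fun k => by rw [pow_add]; ring
  rw [← ENNReal.ofReal_tsum_of_nonneg (fun k => by positivity)]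
  · apply ENNReal.ofReal_le_ofReal
    simp_rw [e]
    rw [tsum_mul_left, tsum_geometric_two]
    apply le_of_eq; ring
  · simp_rw [e]; exact summable_geometric_two.mul_left _

lemma gcl_chain {f : ℝ → ℝ} (hf : Continuous f) {r : ℝ} (hr0 : 0 < r) (hr1 : r < 1) {N m : ℕ}
    (h : ∀ k, m ≤ k → ∀ j : ℤ, |j| ≤ N * 2 ^ k → |f ((j + 1) / 2 ^ k) - f (j / 2 ^ k)| ≤ r ^ k)
    {t : ℝ} (ht : |t| ≤ N) {j : ℤ} (hj : |2 ^ m * t - j| < 1) : 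
    |f t - f (j / 2 ^ m)| ≤ r ^ m * (1 / (1 - r) + 1) := by
  have hfl : ∀ k : ℕ, |⌊2 ^ k * t⌋| ≤ (N * 2 ^ k : ℤ) := by
    intro k
    obtain ⟨a, b⟩ := abs_le.1 ht
    rw [abs_le]
    have h2 : (0:ℝ) < 2 ^ k := by positivity
    constructor
    · rw [Int.le_floor]; push_cast; nlinarith
    · have : ((⌊2 ^ k * t⌋ : ℤ) : ℝ) ≤ ((N * 2 ^ k : ℤ) : ℝ) := by
        push_cast
        exact (Int.floor_le _).trans (by nlinarith)
      exact_mod_cast this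
  let p : ℕ → ℝ := fun k => f (⌊2 ^ (m + k) * t⌋ / 2 ^ (m + k))
  have hp : Tendsto p atTop (𝓝 (f t)) := by
    refine (hf.tendsto t).comp ?_
    have h1 : Tendsto (fun k : ℕ => t - (1 / 2 : ℝ) ^ (m + k)) atTop (𝓝 t) := by
      have : Tendsto (fun k : ℕ => (1 / 2 : ℝ) ^ (m + k)) atTop (𝓝 0) := by
        have := tendsto_pow_atTop_nhds_zero_of_lt_one (r := (1/2:ℝ)) (by norm_num) (by norm_num)
        simp_rw [add_comm m]
        exact (tendsto_add_atTop_iff_nat m).2 this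
      simpa using tendsto_const_nhds.sub this
    refine tendsto_of_tendsto_of_tendsto_of_le_of_le h1 tendsto_const_nhds ?_ ?_
    · intro k
      have h2 : (0:ℝ) < 2 ^ (m + k) := by positivity
      have := Int.lt_floor_add_one ((2:ℝ) ^ (m + k) * t)
      have h5 : (2:ℝ) ^ (m + k) * (1 / 2) ^ (m + k) = 1 := by rw [← mul_pow]; norm_num
      show t - (1 / 2) ^ (m + k) ≤ _
      rw [le_div_iff₀ h2]
      nlinarith
    · intro k
      have h2 : (0:ℝ) < 2 ^ (m + k) := by positivity
      have := Int.floor_le ((2:ℝ) ^ (m + k) * t)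
      show _ ≤ t
      rw [div_le_iff₀ h2]
      linarith
  have hstep : ∀ k, dist (p k) (p (k + 1)) ≤ r ^ m * r ^ k := by
    intro k
    set q := m + k with hq
    set a := ⌊(2:ℝ) ^ q * t⌋ with ha
    have e2 : (2:ℝ) ^ (q + 1) * t = 2 * (2 ^ q * t) := by rw [pow_succ]; ring
    have hpe : p k = f (((2 * a : ℤ) : ℝ) / 2 ^ (q + 1)) := by
      show f _ = f _
      congr 1
      rw [pow_succ]; push_cast; field_simp; rw [← hq, ← ha]; ring
    have hpe2 : p (k + 1) = f (⌊(2:ℝ) ^ (q + 1) * t⌋ / 2 ^ (q + 1)) := rfl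
    have hr2 : (0:ℝ) ≤ r ^ m * r ^ k := by positivity
    have hcase : ⌊(2:ℝ) ^ (q + 1) * t⌋ = 2 * a ∨ ⌊(2:ℝ) ^ (q + 1) * t⌋ = 2 * a + 1 := by
      have h1 := Int.floor_le ((2:ℝ) ^ q * t)
      have h2 := Int.lt_floor_add_one ((2:ℝ) ^ q * t)
      rw [← ha] at h1 h2
      have h3 : 2 * a ≤ ⌊(2:ℝ) ^ (q + 1) * t⌋ := by
        rw [Int.le_floor, e2]; push_cast; linarith
      have h4 : ⌊(2:ℝ) ^ (q + 1) * t⌋ < 2 * a + 2 := by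
        rw [Int.floor_lt, e2]; push_cast; linarith
      omega
    rcases hcase with hc | hc
    · rw [hpe, hpe2, hc, dist_self]; exact hr2
    · rw [hpe, hpe2, hc, dist_comm, Real.dist_eq]
      have hb := hfl (q + 1)
      have hb2 := hfl q
      have h6 : |2 * a| ≤ (N * 2 ^ (q + 1) : ℤ) := by
        rw [abs_mul, pow_succ]
        have : |(2:ℤ)| = 2 := rfl
        rw [this]; linarith
      have := h (q + 1) (by omega) (2 * a) h6
      push_cast at this ⊢
      refine this.trans ?_
      rw [← pow_add, ← hq]
      exact pow_le_pow_of_le_one hr0.le hr1.le (by omega)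
  have h0 := dist_le_of_le_geometric_of_tendsto₀ r (r ^ m) hr1 hstep hp
  have hp0 : p 0 = f (⌊2 ^ m * t⌋ / 2 ^ m) := rfl
  rw [hp0, dist_comm, Real.dist_eq] at h0
  have hr3 : 0 < r ^ m := by positivity
  have hcase : j = ⌊(2:ℝ) ^ m * t⌋ ∨ j = ⌊(2:ℝ) ^ m * t⌋ + 1 := by
    have h1 := Int.floor_le ((2:ℝ) ^ m * t)
    have h2 := Int.lt_floor_add_one ((2:ℝ) ^ m * t)
    obtain ⟨h3, h4⟩ := abs_lt.1 hj
    have h5 : ((j:ℤ):ℝ) < ((⌊(2:ℝ) ^ m * t⌋ + 2 : ℤ) : ℝ) := by push_cast; linarith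
    have h6 : ((⌊(2:ℝ) ^ m * t⌋ : ℤ) : ℝ) < ((j + 1 : ℤ) : ℝ) := by push_cast; linarith
    have h7 := Int.cast_lt.1 h5
    have h8 := Int.cast_lt.1 h6
    omega
  have e : r ^ m * (1 / (1 - r) + 1) = r ^ m / (1 - r) + r ^ m := by ring
  rw [e]
  rcases hcase with hc | hc
  · rw [hc]; linarith
  · have := h m le_rfl _ (hfl m)
    rw [hc]; push_cast
    have h9 := abs_sub_le (f t) (f (⌊2 ^ m * t⌋ / 2 ^ m)) (f ((⌊2 ^ m * t⌋ + 1) / 2 ^ m))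
    rw [abs_sub_comm] at this
    linarith

lemma gcl_interp (n N m : ℕ) (I : Set ℝ) [CompactSpace I] (hI : ∀ t ∈ I, |t| ≤ N) :
    ∃ (K : ℕ) (t : Fin K → ℝ) (L : (Fin K × Fin n → ℝ) → C(I, Fin n → ℝ)), Continuous L ∧ 
    ∀ (X : C(I, Fin n → ℝ)) (Y : ℝ → Fin n → ℝ) (η : ℝ), 0 ≤ η → (∀ s : I, X s = Y s) → 
      (∀ s : I, ∀ j : ℤ, |2 ^ m * (s : ℝ) - j| < 1 → ∀ i, |Y s i - Y (j / 2 ^ m) i| ≤ η) → 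
      dist X (L (fun x => Y (t x.1) x.2)) ≤ η := by
  let K := 2 * N * 2 ^ m + 1
  let jj : Fin K → ℤ := fun a => (a : ℤ) - N * 2 ^ m
  let ψ : Fin K → ℝ → ℝ := fun a s => max 0 (1 - |2 ^ m * s - jj a|)
  let S : ℝ → ℝ := fun s => ∑ a, ψ a s
  have hψ0 : ∀ a s, 0 ≤ ψ a s := fun a s => le_max_left _ _
  have hψc : ∀ a, Continuous (ψ a) := fun a => by fun_prop
  have hSc : Continuous S := continuous_finsetSum _ fun a _ => hψc a
  have hψ : ∀ a s, ψ a s ≠ 0 → |2 ^ m * s - jj a| < 1 := by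
    intro a s h
    by_contra hc
    apply h
    exact max_eq_left (by linarith [not_lt.1 hc])
  have hS : ∀ s : I, 0 < S s := by
    intro ⟨s, hs⟩
    obtain ⟨h1, h2⟩ := abs_le.1 (hI s hs)
    have hp : (0:ℝ) < 2 ^ m := by positivity
    have h3 := Int.floor_le ((2:ℝ) ^ m * s)
    have h4 := Int.lt_floor_add_one ((2:ℝ) ^ m * s)
    have h5 : -(N * 2 ^ m : ℤ) ≤ ⌊(2:ℝ) ^ m * s⌋ := by
      rw [Int.le_floor]; push_cast; nlinarith
    have h6 : ⌊(2:ℝ) ^ m * s⌋ ≤ (N * 2 ^ m : ℤ) := by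
      have : ((⌊(2:ℝ) ^ m * s⌋ : ℤ) : ℝ) ≤ ((N * 2 ^ m : ℤ) : ℝ) := by
        push_cast; nlinarith
      exact_mod_cast this
    obtain ⟨q, hq⟩ := Int.eq_ofNat_of_zero_le (show 0 ≤ ⌊(2:ℝ) ^ m * s⌋ + N * 2 ^ m by linarith)
    have hqK : q < K := by
      have : (q : ℤ) < ((2 * N * 2 ^ m + 1 : ℕ) : ℤ) := by rw [← hq]; push_cast; linarith
      exact_mod_cast this
    have hj : jj ⟨q, hqK⟩ = ⌊(2:ℝ) ^ m * s⌋ := by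
      show (q : ℤ) - N * 2 ^ m = _
      rw [← hq]; ring
    have hpos : 0 < ψ ⟨q, hqK⟩ s := by
      apply lt_max_of_lt_right
      rw [hj, abs_of_nonneg (by linarith)]; linarith
    exact Finset.sum_pos' (fun a _ => hψ0 a s) ⟨_, Finset.mem_univ _, hpos⟩
  let Φ : Fin K × Fin n → C(I, Fin n → ℝ) := fun x => 
    ⟨fun s => Pi.single x.2 (ψ x.1 s / S s), by
      refine (continuous_single x.2).comp ?_
      exact ((hψc _).comp continuous_subtype_val).div (hSc.comp continuous_subtype_val) 
        fun s => (hS s).ne'⟩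
  refine ⟨K, fun a => jj a / 2 ^ m, fun v => ∑ x, v x • Φ x, by fun_prop, ?_⟩
  intro X Y η hη hXY hmod
  rw [ContinuousMap.dist_le hη]
  intro s
  rw [dist_pi_le_iff hη]
  intro i
  have e1 : (∑ x : Fin K × Fin n, Y (jj x.1 / 2 ^ m) x.2 • Φ x) s i = 
      ∑ a, ψ a s / S s * Y (jj a / 2 ^ m) i := by
    rw [ContinuousMap.sum_apply, Finset.sum_apply, Fintype.sum_prod_type]
    refine Finset.sum_congr rfl fun a _ => ?_
    rw [Finset.sum_eq_single i]
    · simp [Φ, mul_comm]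
    · intro k _ hk; simp [Φ, hk.symm]
    · simp
  have e2 : Y s i = ∑ a, ψ a s / S s * Y s i := by
    rw [← Finset.sum_mul, ← Finset.sum_div, div_self (hS s).ne', one_mul]
  rw [e1, hXY, Real.dist_eq, e2, ← Finset.sum_sub_distrib]
  refine (Finset.abs_sum_le_sum_abs _ _).trans ?_
  have e3 : η = ∑ a, ψ a s / S s * η := by
    rw [← Finset.sum_mul, ← Finset.sum_div, div_self (hS s).ne', one_mul]
  rw [e3]
  refine Finset.sum_le_sum fun a _ => ?_
  rw [← mul_sub, abs_mul, abs_of_nonneg (div_nonneg (hψ0 _ _) (hS s).le)]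
  by_cases h : ψ a s = 0
  · simp [h]
  · exact mul_le_mul_of_nonneg_left (hmod s _ (hψ a s h) i) (div_nonneg (hψ0 _ _) (hS s).le)

lemma gcl_modulus {n : ℕ} (N : ℕ) (I : Set ℝ) (hI : ∀ t ∈ I, |t| ≤ N) {Y : ℝ → Fin n → ℝ} 
    (hY : ∀ i, Continuous fun t => Y t i) {η : ℝ} (hη : 0 < η) :
    ∀ᶠ m : ℕ in atTop, ∀ s : I, ∀ j : ℤ, |2 ^ m * (s : ℝ) - j| < 1 → 
      ∀ i, |Y s i - Y (j / 2 ^ m) i| ≤ η := by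
  have hYc : Continuous Y := continuous_pi hY
  have hu := (isCompact_Icc (a := -(N:ℝ) - 1) (b := N + 1)).uniformContinuousOn_of_continuous 
    hYc.continuousOn
  rw [Metric.uniformContinuousOn_iff] at hu
  obtain ⟨e, he, hu⟩ := hu η hη
  have h1 : Tendsto (fun m : ℕ => (1 / 2 : ℝ) ^ m) atTop (𝓝 0) :=
    tendsto_pow_atTop_nhds_zero_of_lt_one (by norm_num) (by norm_num)
  filter_upwards [h1.eventually_lt_const he] with m hm s j hj i
  have hp : (0:ℝ) < 2 ^ m := by positivity
  have hdist : |(s:ℝ) - j / 2 ^ m| ≤ (1 / 2) ^ m := by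
    have : (s:ℝ) - j / 2 ^ m = (2 ^ m * s - j) / 2 ^ m := by field_simp
    rw [this, abs_div, abs_of_pos hp, one_div, inv_pow, ← one_div]
    gcongr
  have h2 : (1 / 2 : ℝ) ^ m ≤ 1 := pow_le_one₀ (by norm_num) (by norm_num)
  obtain ⟨h3, h4⟩ := abs_le.1 (hI s s.2)
  obtain ⟨h5, h6⟩ := abs_le.1 hdist
  have := hu s ⟨by linarith, by linarith⟩ (j / 2 ^ m) ⟨by linarith, by linarith⟩ 
    (by rw [Real.dist_eq]; linarith)
  exact ((dist_le_pi_dist _ _ i).trans this.le)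

lemma gcl_approx {Ω Ω' : Type*} [MeasurableSpace Ω] [MeasurableSpace Ω']
    (P : Measure Ω) (P' : Measure Ω') [IsProbabilityMeasure P] [IsProbabilityMeasure P']
    {E : Type*} [MetricSpace E] [MeasurableSpace E] [BorelSpace E]
    {X : ℕ → Ω → E} {Y : Ω' → E} {Z : ℕ → ℕ → Ω → E} {W : ℕ → Ω' → E}
    (hX : ∀ k, Measurable (X k)) (hY : Measurable Y) (hZ : ∀ m k, Measurable (Z m k)) 
    (hW : ∀ m, Measurable (W m))
    (h1 : ∀ m, ∀ F : BoundedContinuousFunction E ℝ, 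
      Tendsto (fun k => ∫ ω, F (Z m k ω) ∂P) atTop (𝓝 (∫ ω, F (W m ω) ∂P')))
    (h2 : ∀ ω, Tendsto (fun m => W m ω) atTop (𝓝 (Y ω)))
    (h3 : ∀ η > (0:ℝ), ∀ ε > (0:ℝ), ∀ᶠ m in atTop, ∀ᶠ k in atTop, 
      P {ω | η < dist (X k ω) (Z m k ω)} ≤ ENNReal.ofReal ε)
    (F : BoundedContinuousFunction E ℝ) :
    Tendsto (fun k => ∫ ω, F (X k ω) ∂P) atTop (𝓝 (∫ ω, F (Y ω) ∂P')) := by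
  let μ : ℕ → ProbabilityMeasure E := fun k => 
    ⟨P.map (X k), Measure.isProbabilityMeasure_map (hX k).aemeasurable⟩
  let μ' : ProbabilityMeasure E := 
    ⟨P'.map Y, Measure.isProbabilityMeasure_map hY.aemeasurable⟩
  have ht : Tendsto μ atTop (𝓝 μ') := by
    rw [tendsto_iff_forall_lipschitz_integral_tendsto]
    rintro f ⟨C, hC⟩ ⟨L, hL⟩
    have hfm : Measurable f := hL.continuous.measurable
    let f' : BoundedContinuousFunction E ℝ := BoundedContinuousFunction.mkOfBound ⟨f, hL.continuous⟩ C hC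
    have c1 : ∀ k, ∫ x, f x ∂(μ k : Measure E) = ∫ ω, f (X k ω) ∂P := fun k =>
      integral_map (hX k).aemeasurable hL.continuous.aestronglyMeasurable
    have c2 : ∫ x, f x ∂(μ' : Measure E) = ∫ ω, f (Y ω) ∂P' :=
      integral_map hY.aemeasurable hL.continuous.aestronglyMeasurable
    simp_rw [c1, c2]
    have hi : ∀ {g : Ω → E}, Measurable g → Integrable (fun ω => f (g ω)) P := fun hg =>
      Integrable.of_bound (hfm.comp hg).aestronglyMeasurable ‖f'‖ 
        (Eventually.of_forall fun ω => f'.norm_coe_le_norm _)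
    have hlim : Tendsto (fun m => ∫ ω, f (W m ω) ∂P') atTop (𝓝 (∫ ω, f (Y ω) ∂P')) := by
      refine tendsto_integral_of_dominated_convergence (fun _ => ‖f'‖) 
        (fun m => (hfm.comp (hW m)).aestronglyMeasurable) (integrable_const _) 
        (fun m => Eventually.of_forall fun ω => f'.norm_coe_le_norm _) 
        (Eventually.of_forall fun ω => (hL.continuous.tendsto _).comp (h2 ω))
    have hC0 : ∀ x y, |f x - f y| ≤ |C| := fun x y => (hC x y).trans (le_abs_self C)
    rw [Metric.tendsto_nhds]
    intro ε hε
    set η := ε / (8 * (L + 1)) with hη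
    have hηp : 0 < η := by positivity
    set ε' := ε / (8 * (|C| + 1)) with hε'
    have hεp : 0 < ε' := by positivity
    have hm1 := (Metric.tendsto_nhds.1 hlim) (ε / 4) (by positivity)
    obtain ⟨m, hm, hm3⟩ := (hm1.and (h3 η hηp ε' hεp)).exists
    have hk1 := (Metric.tendsto_nhds.1 (h1 m f')) (ε / 4) (by positivity)
    filter_upwards [hk1, hm3] with k hk hk3
    have hk' : dist (∫ ω, f (Z m k ω) ∂P) (∫ ω, f (W m ω) ∂P') < ε / 4 := hk
    have hb : dist (∫ ω, f (X k ω) ∂P) (∫ ω, f (Z m k ω) ∂P) ≤ ε / 4 := by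
      rw [Real.dist_eq, ← integral_sub (hi (hX k)) (hi (hZ m k))]
      set A := toMeasurable P {ω | η < dist (X k ω) (Z m k ω)} with hA
      have hAm : MeasurableSet A := measurableSet_toMeasurable _ _
      have hPA : P.real A ≤ ε' := by
        rw [Measure.real, hA, measure_toMeasurable]
        exact ENNReal.toReal_le_of_le_ofReal hεp.le hk3
      have hAi : Integrable (A.indicator (fun _ => |C|)) P := (integrable_const _).indicator hAm
      calc |∫ ω, f (X k ω) - f (Z m k ω) ∂P| 
          ≤ ∫ ω, (L * η + A.indicator (fun _ => |C|) ω) ∂P := by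
            rw [← Real.norm_eq_abs]
            refine norm_integral_le_of_norm_le ((integrable_const _).add hAi) 
              (Eventually.of_forall fun ω => ?_)
            rw [Real.norm_eq_abs]
            by_cases hω : ω ∈ A
            · simp only [hω, Set.indicator_of_mem]
              have := hC0 (X k ω) (Z m k ω)
              have : 0 ≤ L * η := by positivity
              linarith [hC0 (X k ω) (Z m k ω)]
            · simp only [hω, not_false_eq_true, Set.indicator_of_notMem, add_zero]
              have h5 : dist (X k ω) (Z m k ω) ≤ η := by
                by_contra hc
                exact hω (subset_toMeasurable _ _ (not_le.1 hc))
              have h6 := hL.dist_le_mul (X k ω) (Z m k ω)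
              rw [Real.dist_eq] at h6
              exact h6.trans (mul_le_mul_of_nonneg_left h5 L.2)
        _ = L * η + P.real A * |C| := by
            rw [integral_add (integrable_const _) hAi, integral_indicator_const _ hAm]
            simp
        _ ≤ L * η + ε' * |C| := by gcongr
        _ ≤ ε / 8 + ε / 8 := by
            have a1 : L * η ≤ ε / 8 := by
              rw [hη, mul_div_assoc', div_le_iff₀ (by positivity)]
              nlinarith [L.2]
            have a2 : ε' * |C| ≤ ε / 8 := by
              rw [hε', div_mul_eq_mul_div, div_le_iff₀ (by positivity)]
              nlinarith [abs_nonneg C]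
            linarith
        _ = ε / 4 := by ring
    have t1 := dist_triangle (∫ ω, f (X k ω) ∂P) (∫ ω, f (Z m k ω) ∂P) (∫ ω, f (Y ω) ∂P')
    have t2 := dist_triangle (∫ ω, f (Z m k ω) ∂P) (∫ ω, f (W m ω) ∂P') (∫ ω, f (Y ω) ∂P')
    linarith
  rw [ProbabilityMeasure.tendsto_iff_forall_integral_tendsto] at ht
  have := ht F
  have c1 : ∀ k, ∫ x, F x ∂(μ k : Measure E) = ∫ ω, F (X k ω) ∂P := fun k =>
    integral_map (hX k).aemeasurable F.continuous.aestronglyMeasurable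
  have c2 : ∫ x, F x ∂(μ' : Measure E) = ∫ ω, F (Y ω) ∂P' :=
    integral_map hY.aemeasurable F.continuous.aestronglyMeasurable
  simp_rw [c1, c2] at this
  exact this

lemma gcl_incr {Ω : Type*} [MeasurableSpace Ω] {P : Measure Ω} {σ : ℝ → ℝ} (hσ0 : σ 0 = 0)
    (hσpos : ∀ t > (0:ℝ), 0 < σ t)
    {J : ℝ → Ω → ℝ} (hJ : IsCenteredGaussian1 P J (covFromStd σ))
    {d0 C γ : ℝ} 
    (hpot : ∀ d x, 0 < d → d ≤ d0 → 0 ≤ x → x ≤ 1 → σ (d * x) ≤ C * x ^ γ * σ d)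
    {d : ℝ} (hd : 0 < d) (hdd : d ≤ d0) (k : ℕ) (j : ℤ) :
    ∃ v : NNReal, P.map (fun ω => J (d * ((j + 1) / 2 ^ k)) ω / σ d - J (d * (j / 2 ^ k)) ω / σ d) 
      = gaussianReal 0 v ∧ Real.sqrt v ≤ C * (((2:ℝ) ^ (-(γ / 2))) ^ 2) ^ k := by
  have hg := hJ.2 2 ![d * ((j + 1) / 2 ^ k), d * (j / 2 ^ k)] ![1 / σ d, - (1 / σ d)]
  simp only [Fin.sum_univ_two] at hg
  simp only [Matrix.cons_val_zero, Matrix.cons_val_one] at hg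
  have hs := hσpos d hd
  set x : ℝ := (1 / 2) ^ k with hx
  have hx0 : 0 ≤ x := by positivity
  have hx1 : x ≤ 1 := pow_le_one₀ (by norm_num) (by norm_num)
  have hdx : d * ((j + 1) / 2 ^ k) - d * (j / 2 ^ k) = d * x := by
    rw [hx, one_div, inv_pow]; field_simp; ring
  have hnn : 0 ≤ σ (d * x) := (hσpos _ (by positivity)).le
  refine ⟨((σ (d * x) / σ d) ^ 2).toNNReal, ?_, ?_⟩
  · convert hg using 2
    · ext ω; ring
    · congr 1
      simp only [covFromStd, sub_self, abs_zero, hσ0, 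
        abs_sub_comm (d * (j / 2 ^ k)) (d * ((j + 1) / 2 ^ k))]
      rw [hdx, abs_of_nonneg (by positivity : 0 ≤ d * x)]
      field_simp; ring
  · rw [Real.coe_toNNReal _ (sq_nonneg _), Real.sqrt_sq (by positivity), div_le_iff₀ hs]
    have hxe : (((2:ℝ) ^ (-(γ / 2))) ^ 2) ^ k = x ^ γ := by
     rw [hx, ← Real.rpow_natCast, ← Real.rpow_natCast, ← Real.rpow_natCast, ← Real.rpow_mul (by positivity), 
      ← Real.rpow_mul (by positivity), ← Real.rpow_mul (by positivity), one_div, 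
      Real.inv_rpow (by positivity), ← Real.rpow_neg (by positivity)]
     congr 1; push_cast; ring
    rw [hxe]
    exact hpot d x hd hdd hx0 hx1

lemma gcl_path_meas {Ω : Type*} [MeasurableSpace Ω] {n N : ℕ} {I : Set ℝ} [CompactSpace I] 
    [MeasurableSpace C(I, Fin n → ℝ)] [BorelSpace C(I, Fin n → ℝ)]
    (hI : ∀ t ∈ I, |t| ≤ N) {Y : Ω → ℝ → Fin n → ℝ} (hYm : ∀ t i, Measurable fun ω => Y ω t i)
    (hYc : ∀ ω i, Continuous fun t => Y ω t i) {X : Ω → C(I, Fin n → ℝ)} 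
    (hX : ∀ ω (s : I), X ω s = Y ω s) : Measurable X := by
  choose K t L hLc hL using fun m => gcl_interp n N m I hI
  refine measurable_of_tendsto_metrizable 
    (f := fun m ω => L m (fun x => Y ω (t m x.1) x.2)) ?_ ?_
  · intro m
    exact (hLc m).measurable.comp (measurable_pi_iff.2 fun x => hYm _ _)
  · rw [tendsto_pi_nhds]
    intro ω
    rw [Metric.tendsto_nhds]
    intro ε hε
    filter_upwards [gcl_modulus N I hI (hYc ω) (half_pos hε)] with m hm
    rw [dist_comm]
    exact (hL m (X ω) (Y ω) (ε / 2) (half_pos hε).le (hX ω) hm).trans_lt (half_lt_self hε)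

lemma gcl_main {Ω Ω' : Type*} [MeasurableSpace Ω] [MeasurableSpace Ω']
    (P : Measure Ω) (P' : Measure Ω') [IsProbabilityMeasure P] [IsProbabilityMeasure P']
    {n : ℕ} {σ : ℝ → ℝ} (hσ0 : σ 0 = 0)
    (hσpos : ∀ t > (0:ℝ), 0 < σ t)
    {J : ℝ → Ω → ℝ} (hJcont : ∀ ω, Continuous fun t => J t ω)
    (hJ : IsCenteredGaussian1 P J (covFromStd σ))
    {L : Fin n → Fin n → ℝ → ℝ → ℝ} {B : ℝ → Ω' → Fin n → ℝ} 
    (hBcont : ∀ ω i, Continuous fun t => B t ω i)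
    (hB : IsCenteredGaussianVec P' B L)
    {d0 C γ : ℝ} (hd0 : 0 < d0) (hC : 0 < C) (hγ : 0 < γ)
    (hpot : ∀ d x, 0 < d → d ≤ d0 → 0 ≤ x → x ≤ 1 → σ (d * x) ≤ C * x ^ γ * σ d)
    {d : Fin n → ℕ → ℝ} (hd : ∀ i, Tendsto (d i) atTop (𝓝[>] 0))
    (hlim : ∀ i k t s, Tendsto (fun u => covFromStd σ (d i u * t) (d k u * s) / (σ (d i u) * σ (d k u))) 
      atTop (𝓝 (L i k t s)))
    (I : Set ℝ) [CompactSpace I] {N : ℕ} (hI : ∀ t ∈ I, |t| ≤ N)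
    (X : ℕ → Ω → C(I, Fin n → ℝ)) (hX : ∀ k ω (s : I) i, X k ω s i = J (d i k * s) ω / σ (d i k))
    (Y : Ω' → C(I, Fin n → ℝ)) (hY : ∀ ω (s : I) i, Y ω s i = B s ω i)
    (F : BoundedContinuousFunction C(I, Fin n → ℝ) ℝ) :
    Tendsto (fun k => ∫ ω, F (X k ω) ∂P) atTop (𝓝 (∫ ω, F (Y ω) ∂P')) := by
  borelize C(I, Fin n → ℝ)
  choose K t Li hLc hL using fun m => gcl_interp n N m I hI
  let V : ℕ → Ω → ℝ → Fin n → ℝ := fun k ω s i => J (d i k * s) ω / σ (d i k)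
  have hVm : ∀ k s i, Measurable fun ω => V k ω s i := fun k s i => (hJ.1 _).div_const _
  have hVc : ∀ k ω i, Continuous fun s => V k ω s i := fun k ω i => 
    ((hJcont ω).comp (continuous_const.mul continuous_id)).div_const _
  have hXV : ∀ k ω (s : I), X k ω s = V k ω s := fun k ω s => funext (hX k ω s)
  have hYB : ∀ ω (s : I), Y ω s = B s ω := fun ω s => funext (hY ω s)
  set r : ℝ := (2:ℝ) ^ (-(γ / 2)) with hr
  have hr0 : 0 < r := by positivity
  have hr1 : r < 1 := Real.rpow_lt_one_of_one_lt_of_neg (by norm_num) (by linarith)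
  obtain ⟨D, hD⟩ := gcl_tight P hr0 hr1 hC N
  refine gcl_approx P P' (X := X) (Y := Y) 
    (Z := fun m k ω => Li m (fun x => V k ω (t m x.1) x.2))
    (W := fun m ω => Li m (fun x => B (t m x.1) ω x.2)) ?_ ?_ ?_ ?_ ?_ ?_ ?_ F
  · exact fun k => gcl_path_meas hI (hVm k) (hVc k) (hXV k)
  · exact gcl_path_meas (Y := fun ω s => B s ω) hI hB.1 hBcont hYB
  · exact fun m k => (hLc m).measurable.comp (measurable_pi_iff.2 fun x => hVm _ _ _)
  · exact fun m => (hLc m).measurable.comp (measurable_pi_iff.2 fun x => hB.1 _ _)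
  · intro m G
    exact gcl_fdd_app P P' hJ hB hlim (t m) (G.compContinuous ⟨Li m, hLc m⟩)
  · intro ω
    rw [Metric.tendsto_nhds]
    intro ε hε
    filter_upwards [gcl_modulus N I hI (hBcont ω) (half_pos hε)] with m hm
    rw [dist_comm]
    exact (hL m (Y ω) (fun s => B s ω) (ε / 2) (half_pos hε).le (hYB ω) hm).trans_lt (half_lt_self hε)
  · intro η hη ε hε
    have l1 : Tendsto (fun m : ℕ => r ^ m * (1 / (1 - r) + 1)) atTop (𝓝 0) := by
      simpa using (tendsto_pow_atTop_nhds_zero_of_lt_one hr0.le hr1).mul_const (1 / (1 - r) + 1)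
    have l2 : Tendsto (fun m : ℕ => (n:ℝ) * (D * (1 / 2) ^ m)) atTop (𝓝 0) := by
      have := ((tendsto_pow_atTop_nhds_zero_of_lt_one (r := (1/2:ℝ)) (by norm_num) 
        (by norm_num)).const_mul D).const_mul (n:ℝ)
      simpa using this
    filter_upwards [l1.eventually_le_const hη, l2.eventually_le_const hε] with m hm1 hm2
    have hk1 : ∀ᶠ k in atTop, ∀ i, 0 < d i k := by
      rw [eventually_all]; exact fun i => hd i self_mem_nhdsWithin
    have hk2 : ∀ᶠ k in atTop, ∀ i, d i k ≤ d0 := by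
      rw [eventually_all]
      exact fun i => ((hd i).mono_right nhdsWithin_le_nhds).eventually_le_const hd0
    filter_upwards [hk1, hk2] with k hk1 hk2
    have hbad := fun i => hD (fun s ω => V k ω s i) (fun s => hVm k s i) 
      (fun q j => gcl_incr hσ0 hσpos hJ hpot (hk1 i) (hk2 i) q j) m
    have hsub : {ω | η < dist (X k ω) (Li m (fun x => V k ω (t m x.1) x.2))} ⊆ 
        ⋃ i, {ω | ¬ ∀ q, m ≤ q → ∀ j : ℤ, |j| ≤ N * 2 ^ q → 
          |V k ω ((j + 1) / 2 ^ q) i - V k ω (j / 2 ^ q) i| ≤ r ^ q} := by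
      intro ω hω
      by_contra hc
      rw [Set.mem_iUnion, not_exists] at hc
      have hc' : ∀ i, ∀ q, m ≤ q → ∀ j : ℤ, |j| ≤ N * 2 ^ q → 
          |V k ω ((j + 1) / 2 ^ q) i - V k ω (j / 2 ^ q) i| ≤ r ^ q := fun i => not_not.1 (hc i)
      have hle := hL m (X k ω) (V k ω) η hη.le (hXV k ω) fun s j hj i => 
        (gcl_chain (hVc k ω i) hr0 hr1 (hc' i) (hI s s.2) hj).trans hm1
      exact absurd hle (not_le.2 hω)
    calc _ ≤ _ := measure_mono hsub
      _ ≤ _ := measure_iUnion_fintype_le _ _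
      _ ≤ ∑ i : Fin n, ENNReal.ofReal (D * (1 / 2) ^ m) := Finset.sum_le_sum fun i _ => hbad i
      _ = ENNReal.ofReal ((n:ℝ) * (D * (1 / 2) ^ m)) := by
        rw [Finset.sum_const, nsmul_eq_mul, ENNReal.ofReal_mul (Nat.cast_nonneg n), ENNReal.ofReal_natCast,
          Finset.card_univ, Fintype.card_fin]
      _ ≤ _ := ENNReal.ofReal_le_ofReal hm2

/-- **Lemma 1 (light traffic).** Under L1, L2, N1–N3 and `r i u → ∞`, the scaled
Gaussian input `Jᵟ_u` converges in distribution in `C([−T,T] → ℝⁿ)` to `B_λ`, for every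
`T > 0`. -/
theorem gauss_convergence_light
    {Ω Ω' : Type*} [MeasurableSpace Ω] [MeasurableSpace Ω']
    (P : Measure Ω) (P' : Measure Ω')
    [IsProbabilityMeasure P] [IsProbabilityMeasure P']
    {n : ℕ} (hn : 0 < n)
    -- the Gaussian input process and its standard deviation function
    (σ : ℝ → ℝ) (hσcont : ContinuousOn σ (Set.Ici 0)) (hσ0 : σ 0 = 0)
    (hσpos : ∀ t > (0:ℝ), 0 < σ t)
    (J : ℝ → Ω → ℝ) (hJcont : ∀ ω, Continuous fun t => J t ω)
    (hJ0 : ∀ ω, J 0 ω = 0)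
    (hJgauss : IsCenteredGaussian1 P J (covFromStd σ))
    -- assumption L1
    (lam : ℝ) (hlam : lam ∈ Set.Ioo (0:ℝ) 1)
    (hL1 : ∀ t > (0:ℝ), Tendsto (fun x => σ (t * x) / σ x) (𝓝[>] 0) (𝓝 (t ^ lam)))
    -- assumption L2
    (t₀ β C : ℝ) (ht₀ : 0 < t₀) (hβ : β ∈ Set.Ioo (0:ℝ) 1) (hC : 0 < C)
    (hL2 : ∀ t > t₀, σ t ≤ C * t ^ β)
    -- the routing matrix
    (Pm : Matrix (Fin n) (Fin n) ℝ)
    (hPnn : ∀ i j, 0 ≤ Pm i j)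
    (hPut : ∀ i j, j ≤ i → Pm i j = 0)
    (hPcol : ∀ j i i', 0 < Pm i j → 0 < Pm i' j → i = i')
    -- output rates: positive, monotone in u, tending to ∞ (light traffic)
    (r : Fin n → ℝ → ℝ)
    (hrpos : ∀ i, ∀ u > (0:ℝ), 0 < r i u)
    (hrmono : ∀ i, Monotone (r i) ∨ Antitone (r i))
    (hrlim : ∀ i, Tendsto (r i) atTop atTop)
    -- assumption N1
    (hN1 : ∀ i j, 0 < Pm i j → ∀ u > (0:ℝ), r j u < Pm i j * r i u)
    -- assumption N3
    (ρ : Fin n → Fin n → ℝ)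
    (hρmem : ∀ i j, i ≤ j → ρ i j ∈ Set.Icc (0:ℝ) 1)
    (hN3 : ∀ i j, i ≤ j → Tendsto (fun u => r j u / r i u) atTop (𝓝 (ρ i j)))
    -- the scaling function δ, solving x δ(x) = σ(δ(x)) near ∞
    (δ : ℝ → ℝ) (hδ : ∀ᶠ x in atTop, 0 < δ x ∧ x * δ x = σ (δ x))
    -- the limiting n-dimensional Gaussian process B_λ
    (B : ℝ → Ω' → Fin n → ℝ)
    (hBcont : ∀ ω i, Continuous fun t => B t ω i)
    (hBgauss : IsCenteredGaussianVec P' B (limCovMat lam ρ)) :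
    -- conclusion: Jᵟ_u → B_λ in distribution in C([−T,T] → ℝⁿ), for every T > 0
    ∀ T > (0:ℝ),
      TendstoInDistOnCompacts P P' (Set.Icc (-T) T) n
        (fun u ω t i => J (δ (r i u) * t) ω / σ (δ (r i u)))
        (fun ω t i => B t ω i) := by
  intro T hT F
  obtain ⟨j, hj⟩ := gcl_hilbert P hσ0 hJgauss
  have tri := gcl_tri hσ0 hσpos hj
  obtain ⟨d0, hd0, C', hC', γ, hγ, γ', hγ', hpot1, hpot⟩ := 
    gcl_potter hσcont hσ0 tri hσpos hlam hL1
  have hδ0 := gcl_delta hσcont ht₀ hβ hC hL2 hδ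
  obtain ⟨N, hN⟩ := exists_nat_ge T
  refine tendsto_of_seq_tendsto fun u hu => ?_
  have hI : ∀ t ∈ Set.Icc (-T) T, |t| ≤ (N : ℝ) := fun t ht => (abs_le.2 ht).trans hN
  have hru : ∀ i, Tendsto (fun k => r i (u k)) atTop atTop := fun i => (hrlim i).comp hu
  have hd : ∀ i, Tendsto (fun k => δ (r i (u k))) atTop (𝓝[>] 0) := fun i => hδ0.comp (hru i)
  have hlim := gcl_covMat hσ0 hσpos hlam hL1 hd0 hC' hγ hγ' hpot1 hpot hj
    (r := fun i k => r i (u k)) (d := fun i k => δ (r i (u k))) hd 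
    (fun i => (hru i).eventually_gt_atTop 0)
    (fun i => ((hru i).eventually hδ).mono fun k hk => hk.2)
    hρmem (fun i j hij => (hN3 i j hij).comp hu)
  let F' : BoundedContinuousFunction C(Set.Icc (-T) T, Fin n → ℝ) ℝ := 
    F.compContinuous ⟨ContinuousMap.toUniformOnFunIsCompact, 
      ContinuousMap.isUniformEmbedding_toUniformOnFunIsCompact.uniformContinuous.continuous⟩
  exact gcl_main P P' hσ0 hσpos hJcont hJgauss hBcont hBgauss hd0 hC' hγ hpot1 
    (d := fun i k => δ (r i (u k))) hd hlim (Set.Icc (-T) T) hI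
    (fun k ω => ⟨fun s i => J (δ (r i (u k)) * s) ω / σ (δ (r i (u k))), 
      continuous_pi fun i => ((hJcont ω).comp 
        (continuous_const.mul continuous_subtype_val)).div_const _⟩)
    (fun _ _ _ _ => rfl)
    (fun ω => ⟨fun s i => B s ω i, continuous_pi fun i => 
      (hBcont ω i).comp continuous_subtype_val⟩)
    (fun _ _ _ => rfl) F'
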